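/- arXiv:2104.03029 — 5 statements merged into one kernel-verified Lean document; each statement's English description precedes it below -/
import Mathlib

section
/- Let A be a local ring and I ⊆ A an ideal, and let r ≥ 1. Then the canonical map K̃^M_r(A,I) → K^M_r(A,I) is surjective, and it is an isomorphism if the residue field of A is infinite. -/
noncomputable section

namespace MilnorKTheory

/-- The tensor algebra `T_*(A^×)` over `ℤ` of the unit group of `A` (written additively). -/
abbrev PreK (A : Type*) [CommRing A] : Type _ := TensorAlgebra ℤ (Additive Aˣ)

/-- The element `a₁ ⊗ ⋯ ⊗ a_r` of the tensor algebra `T_*(A^×)`. -/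
def preSymbol {A : Type*} [CommRing A] : List Aˣ → PreK A
  | [] => 1
  | a :: l => TensorAlgebra.ι ℤ (Additive.ofMul a) * preSymbol l

/-- The relation cutting out Kato's Milnor ring: kill every homogeneous element
`a₁ ⊗ ⋯ ⊗ a_s` with `s ≥ 2` such that `a_i + a_j = 1` for some `i ≠ j`. -/
def katoRel (A : Type*) [CommRing A] : PreK A → PreK A → Prop := fun x y =>
  y = 0 ∧ ∃ l : List Aˣ, 2 ≤ l.length ∧
    (∃ i j : ℕ, ∃ hi : i < l.length, ∃ hj : j < l.length,
      i ≠ j ∧ ((l[i]'hi : A) + (l[j]'hj : A) = 1)) ∧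
    x = preSymbol l

/-- The relation cutting out the weak Milnor ring: kill the degree-2 elements
`a₁ ⊗ a₂` with `a₁ + a₂ = 1`. -/
def tildeRel (A : Type*) [CommRing A] : PreK A → PreK A → Prop := fun x y =>
  y = 0 ∧ ∃ a b : Aˣ, ((a : A) + (b : A) = 1) ∧ x = preSymbol [a, b]

/-- The (graded) quotient `T_*(A^×)/(Kato's Steinberg ideal)`, whose degree-`r` part is
Kato's Milnor K-group `K^M_r(A)`. -/
abbrev KRing (A : Type*) [CommRing A] : Type _ := RingQuot (katoRel A)

/-- The (graded) quotient `T_*(A^×)/(a ⊗ b : a + b = 1)`, whose degree-`r` part is the group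
`K̃^M_r(A)`. -/
abbrev TRing (A : Type*) [CommRing A] : Type _ := RingQuot (tildeRel A)

/-- The Milnor symbol `{a₁, …, a_r}` in Kato's Milnor ring. -/
def ksymbol {A : Type*} [CommRing A] (l : List Aˣ) : KRing A :=
  RingQuot.mkRingHom _ (preSymbol l)

/-- The Milnor symbol `{a₁, …, a_r}` in the weak Milnor ring. -/
def tsymbol {A : Type*} [CommRing A] (l : List Aˣ) : TRing A :=
  RingQuot.mkRingHom _ (preSymbol l)

section maps

variable {A B : Type*} [CommRing A] [CommRing B]

/-- The map of tensor algebras induced by a ring homomorphism `A →+* B` via the induced map of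
unit groups. -/
def preMap (φ : A →+* B) : PreK A →ₐ[ℤ] PreK B :=
  TensorAlgebra.lift ℤ ((TensorAlgebra.ι ℤ).comp
    ((MonoidHom.toAdditive (Units.map (φ : A →* B))).toIntLinearMap))

lemma preMap_preSymbol (φ : A →+* B) (l : List Aˣ) :
    preMap φ (preSymbol l) = preSymbol (l.map (Units.map (φ : A →* B))) := by
  induction l with
  | nil => simp [preSymbol]
  | cons a l ih =>
      simp only [preSymbol, map_mul, ih, List.map_cons]
      congr 1
      exact TensorAlgebra.lift_ι_apply _ _

/-- Functoriality of Kato's Milnor ring. -/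
def kmap (φ : A →+* B) : KRing A →+* KRing B :=
  RingQuot.lift ⟨(RingQuot.mkRingHom (katoRel B)).comp (preMap φ).toRingHom, by
    rintro x y ⟨rfl, l, hlen, ⟨i, j, hi, hj, hij, hsum⟩, rfl⟩
    simp only [RingHom.comp_apply, map_zero, AlgHom.toRingHom_eq_coe, RingHom.coe_coe]
    rw [preMap_preSymbol]
    refine (RingQuot.mkRingHom_rel ?_).trans (map_zero _)
    refine ⟨rfl, l.map (Units.map (φ : A →* B)), by simpa using hlen,
      ⟨i, j, by simpa using hi, by simpa using hj, hij, ?_⟩, rfl⟩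
    simp only [List.getElem_map]
    show φ _ + φ _ = 1
    rw [← map_add, hsum, map_one]⟩

/-- Functoriality of the weak Milnor ring. -/
def tmap (φ : A →+* B) : TRing A →+* TRing B :=
  RingQuot.lift ⟨(RingQuot.mkRingHom (tildeRel B)).comp (preMap φ).toRingHom, by
    rintro x y ⟨rfl, a, b, hsum, rfl⟩
    simp only [RingHom.comp_apply, map_zero, AlgHom.toRingHom_eq_coe, RingHom.coe_coe]
    rw [preMap_preSymbol]
    refine (RingQuot.mkRingHom_rel ?_).trans (map_zero _)
    refine ⟨rfl, Units.map (φ : A →* B) a, Units.map (φ : A →* B) b, ?_, rfl⟩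
    show φ _ + φ _ = 1
    rw [← map_add, hsum, map_one]⟩

/-- The canonical map `K̃^M_*(A) → K^M_*(A)`. -/
def tToK (A : Type*) [CommRing A] : TRing A →+* KRing A :=
  RingQuot.lift ⟨RingQuot.mkRingHom (katoRel A), by
    rintro x y ⟨rfl, a, b, hsum, rfl⟩
    rw [map_zero]
    refine (RingQuot.mkRingHom_rel ?_).trans (map_zero _)
    exact ⟨rfl, [a, b], by norm_num,
      ⟨0, 1, by norm_num, by norm_num, by norm_num, by simpa using hsum⟩, rfl⟩⟩

end maps

section groups

variable (A : Type*) [CommRing A]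

/-- The Milnor K-group `K^M_r(A)`: the degree-`r` part of Kato's Milnor ring, i.e. the
additive subgroup generated by the Milnor symbols of length `r`. -/
def KGroup (r : ℕ) : AddSubgroup (KRing A) :=
  AddSubgroup.closure { x | ∃ l : List Aˣ, l.length = r ∧ x = ksymbol l }

/-- The group `K̃^M_r(A)`: the degree-`r` part of the weak Milnor ring. -/
def TGroup (r : ℕ) : AddSubgroup (TRing A) :=
  AddSubgroup.closure { x | ∃ l : List Aˣ, l.length = r ∧ x = tsymbol l }

/-- The relative Milnor K-group `K^M_r(A, I)`: the kernel of
`K^M_r(A) → K^M_r(A/I)`. -/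
def relKGroup (I : Ideal A) (r : ℕ) : AddSubgroup (KRing A) :=
  KGroup A r ⊓ AddMonoidHom.ker (kmap (Ideal.Quotient.mk I)).toAddMonoidHom

/-- The relative group `K̃^M_r(A, I)`: the kernel of `K̃^M_r(A) → K̃^M_r(A/I)`. -/
def relTGroup (I : Ideal A) (r : ℕ) : AddSubgroup (TRing A) :=
  TGroup A r ⊓ AddMonoidHom.ker (tmap (Ideal.Quotient.mk I)).toAddMonoidHom

end groups

end MilnorKTheory

end

namespace MilnorKTheory

section presentation

variable {A : Type*} [CommRing A]

lemma preSymbol_append (l m : List Aˣ) :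
    preSymbol (l ++ m) = preSymbol l * preSymbol m := by
  induction l with
  | nil => simp [preSymbol]
  | cons a l ih => simp [preSymbol, ih, mul_assoc]

/-- The additive subgroup of the tensor algebra spanned by Kato's relations. -/
def katoSpan (A : Type*) [CommRing A] : AddSubgroup (PreK A) :=
  AddSubgroup.closure {x | katoRel A x 0}

/-- The degree-`r` part of the tensor algebra. -/
def preGroup (A : Type*) [CommRing A] (r : ℕ) : AddSubgroup (PreK A) :=
  AddSubgroup.closure {x | ∃ l : List Aˣ, l.length = r ∧ x = preSymbol l}

lemma mul_mem_katoSpan_left (u : PreK A) : ∀ x ∈ katoSpan A, u * x ∈ katoSpan A := by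
  induction u using TensorAlgebra.induction with
  | algebraMap n =>
      intro x hx
      simpa [Algebra.algebraMap_eq_smul_one] using zsmul_mem hx n
  | ι a =>
      intro x hx
      induction hx using AddSubgroup.closure_induction with
      | mem x hx =>
          obtain ⟨-, l, hlen, ⟨i, j, hi, hj, hij, hsum⟩, rfl⟩ := hx
          refine AddSubgroup.subset_closure ⟨rfl, Additive.toMul a :: l, ?_,
            ⟨i + 1, j + 1, ?_, ?_, ?_, ?_⟩, rfl⟩
          · simp only [List.length_cons]; omega
          · simpa using hi
          · simpa using hj
          · simpa using hij
          · simpa using hsum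
      | zero => simp [zero_mem]
      | add x y _ _ hx hy => rw [mul_add]; exact add_mem hx hy
      | neg x _ hx => rw [mul_neg]; exact neg_mem hx
  | mul u v hu hv => intro x hx; rw [mul_assoc]; exact hu _ (hv _ hx)
  | add u v hu hv => intro x hx; rw [add_mul]; exact add_mem (hu _ hx) (hv _ hx)

lemma mul_mem_katoSpan_right (u : PreK A) : ∀ x ∈ katoSpan A, x * u ∈ katoSpan A := by
  induction u using TensorAlgebra.induction with
  | algebraMap n =>
      intro x hx
      rw [← Algebra.commutes]
      simpa [Algebra.algebraMap_eq_smul_one] using zsmul_mem hx n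
  | ι a =>
      intro x hx
      induction hx using AddSubgroup.closure_induction with
      | mem x hx =>
          obtain ⟨-, l, hlen, ⟨i, j, hi, hj, hij, hsum⟩, rfl⟩ := hx
          refine AddSubgroup.subset_closure ⟨rfl, l ++ [Additive.toMul a], ?_,
            ⟨i, j, ?_, ?_, hij, ?_⟩, ?_⟩
          · simp only [List.length_append]; omega
          · simp only [List.length_append]; omega
          · simp only [List.length_append]; omega
          · rwa [List.getElem_append_left hi, List.getElem_append_left hj]
          · simp [preSymbol_append, preSymbol]
      | zero => simp [zero_mem]
      | add x y _ _ hx hy => rw [add_mul]; exact add_mem hx hy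
      | neg x _ hx => rw [neg_mul]; exact neg_mem hx
  | mul u v hu hv => intro x hx; rw [← mul_assoc]; exact hv _ (hu _ hx)
  | add u v hu hv => intro x hx; rw [mul_add]; exact add_mem (hu _ hx) (hv _ hx)

lemma sub_mem_katoSpan_of_rel {x y : PreK A} (h : RingQuot.Rel (katoRel A) x y) :
    x - y ∈ katoSpan A := by
  induction h with
  | of h =>
      obtain ⟨rfl, h⟩ := h
      rw [sub_zero]
      exact AddSubgroup.subset_closure ⟨rfl, h⟩
  | add_left _ ih => simpa using ih
  | mul_left _ ih => rw [← sub_mul]; exact mul_mem_katoSpan_right _ _ ih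
  | mul_right _ ih => rw [← mul_sub]; exact mul_mem_katoSpan_left _ _ ih

lemma mkRingHom_katoRel_eq_zero_iff {x : PreK A} :
    RingQuot.mkRingHom (katoRel A) x = 0 ↔ x ∈ katoSpan A := by
  constructor
  · intro h
    rw [← map_zero (RingQuot.mkRingHom (katoRel A))] at h
    simp only [RingQuot.mkRingHom_def, RingHom.coe_mk, MonoidHom.coe_mk, OneHom.coe_mk,
      RingQuot.mk.injEq] at h
    have key : ∀ {x y : PreK A}, Relation.EqvGen (RingQuot.Rel (katoRel A)) x y →
        x - y ∈ katoSpan A := by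
      intro x y h
      induction h with
      | rel x y h => exact sub_mem_katoSpan_of_rel h
      | refl x => simp [zero_mem]
      | symm x y _ ih => rw [← neg_sub]; exact neg_mem ih
      | trans x y z _ _ h₁ h₂ => simpa using add_mem h₁ h₂
    simpa using key (Quot.eqvGen_exact h)
  · intro h
    induction h using AddSubgroup.closure_induction with
    | mem x hx =>
        have hx : katoRel A x 0 := hx
        exact (RingQuot.mkRingHom_rel hx).trans (map_zero _)
    | zero => exact map_zero _
    | add x y _ _ hx hy => rw [map_add, hx, hy, add_zero]
    | neg x _ hx => rw [map_neg, hx, neg_zero]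

lemma map_preGroup_katoRel (r : ℕ) :
    (preGroup A r).map (RingQuot.mkRingHom (katoRel A)).toAddMonoidHom = KGroup A r := by
  rw [preGroup, KGroup, AddMonoidHom.map_closure]
  congr 1
  ext x
  constructor
  · rintro ⟨_, ⟨l, hl, rfl⟩, rfl⟩
    exact ⟨l, hl, rfl⟩
  · rintro ⟨l, hl, rfl⟩
    exact ⟨_, ⟨l, hl, rfl⟩, rfl⟩

lemma map_preGroup_tildeRel (r : ℕ) :
    (preGroup A r).map (RingQuot.mkRingHom (tildeRel A)).toAddMonoidHom = TGroup A r := by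
  rw [preGroup, TGroup, AddMonoidHom.map_closure]
  congr 1
  ext x
  constructor
  · rintro ⟨_, ⟨l, hl, rfl⟩, rfl⟩
    exact ⟨l, hl, rfl⟩
  · rintro ⟨l, hl, rfl⟩
    exact ⟨_, ⟨l, hl, rfl⟩, rfl⟩

/-- The projection of the tensor algebra onto its degree-`r` part. -/
def preProj (A : Type*) [CommRing A] (r : ℕ) : PreK A →+ PreK A :=
  GradedRing.proj
    (fun i : ℕ => LinearMap.range (TensorAlgebra.ι ℤ : Additive Aˣ →ₗ[ℤ] PreK A) ^ i) r

lemma preSymbol_mem_range_pow (l : List Aˣ) :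
    preSymbol l ∈
      LinearMap.range (TensorAlgebra.ι ℤ : Additive Aˣ →ₗ[ℤ] PreK A) ^ l.length := by
  induction l with
  | nil => exact SetLike.GradedOne.one_mem
  | cons a l ih =>
      rw [List.length_cons, pow_succ']
      exact Submodule.mul_mem_mul (LinearMap.mem_range_self _ _) ih

lemma preProj_preSymbol_same (l : List Aˣ) :
    preProj A l.length (preSymbol l) = preSymbol l :=
  DirectSum.decompose_of_mem_same _ (preSymbol_mem_range_pow l)

lemma preProj_preSymbol_ne {r : ℕ} (l : List Aˣ) (h : l.length ≠ r) :
    preProj A r (preSymbol l) = 0 :=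
  DirectSum.decompose_of_mem_ne _ (preSymbol_mem_range_pow l) h

lemma preProj_of_mem_preGroup {r : ℕ} {x : PreK A} (hx : x ∈ preGroup A r) :
    preProj A r x = x := by
  induction hx using AddSubgroup.closure_induction with
  | mem x hx =>
      obtain ⟨l, rfl, rfl⟩ := hx
      exact preProj_preSymbol_same l
  | zero => exact map_zero _
  | add x y _ _ hx hy => rw [map_add, hx, hy]
  | neg x _ hx => rw [map_neg, hx]

end presentation

section functoriality

variable {A B : Type*} [CommRing A] [CommRing B]

@[simp]
lemma kmap_mk (φ : A →+* B) (x : PreK A) :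
    kmap φ (RingQuot.mkRingHom (katoRel A) x) = RingQuot.mkRingHom (katoRel B) (preMap φ x) :=
  RingQuot.lift_mkRingHom_apply _ _ _

@[simp]
lemma tmap_mk (φ : A →+* B) (x : PreK A) :
    tmap φ (RingQuot.mkRingHom (tildeRel A) x) = RingQuot.mkRingHom (tildeRel B) (preMap φ x) :=
  RingQuot.lift_mkRingHom_apply _ _ _

@[simp]
lemma tToK_mk (x : PreK A) :
    tToK A (RingQuot.mkRingHom (tildeRel A) x) = RingQuot.mkRingHom (katoRel A) x :=
  RingQuot.lift_mkRingHom_apply _ _ _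

lemma kmap_tToK (φ : A →+* B) (x : TRing A) : kmap φ (tToK A x) = tToK B (tmap φ x) := by
  obtain ⟨x, rfl⟩ := RingQuot.mkRingHom_surjective _ x
  simp

lemma preMap_mem_preGroup (φ : A →+* B) {r : ℕ} {x : PreK A} (hx : x ∈ preGroup A r) :
    preMap φ x ∈ preGroup B r := by
  induction hx using AddSubgroup.closure_induction with
  | mem x hx =>
      obtain ⟨l, rfl, rfl⟩ := hx
      exact AddSubgroup.subset_closure ⟨_, by simp, preMap_preSymbol φ l⟩
  | zero => simp [zero_mem]
  | add x y _ _ hx hy => rw [map_add]; exact add_mem hx hy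
  | neg x _ hx => rw [map_neg]; exact neg_mem hx

lemma preSymbol_eq_zero_of_subsingleton [Subsingleton A] {l : List Aˣ} (hl : l ≠ []) :
    preSymbol l = 0 := by
  cases l with
  | nil => exact absurd rfl hl
  | cons a l =>
      have ha : a = 1 := Units.ext (Subsingleton.elim _ _)
      simp [preSymbol, ha]

/-- Along a surjection out of a local ring onto a nonzero ring, a list of units two of whose
entries add up to `1` lifts to such a list. -/
lemma exists_lift_list [IsLocalRing A] [Nontrivial B] (φ : A →+* B)
    (hφ : Function.Surjective φ) (l : List Bˣ) {i j : ℕ} (hi : i < l.length)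
    (hj : j < l.length) (hij : i ≠ j) (hsum : (l[i] : B) + (l[j] : B) = 1) :
    ∃ m : List Aˣ, m.map (Units.map (φ : A →* B)) = l ∧
      ∃ (hi : i < m.length) (hj : j < m.length), (m[i] : A) + (m[j] : A) = 1 := by
  have : IsLocalHom φ := .of_surjective φ hφ
  choose g hg using IsLocalRing.surjective_units_map_of_local_ringHom φ hφ this
  have hgv : ∀ u : Bˣ, φ (g u) = u := fun u => congrArg Units.val (hg u)
  have hv : φ (1 - g l[i]) = l[j] := by
    rw [map_sub, map_one, hgv, ← hsum, add_sub_cancel_left]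
  have hu : IsUnit (1 - (g l[i] : A)) :=
    isUnit_of_map_unit φ _ (hv ▸ Units.isUnit _)
  refine ⟨(l.map g).set j hu.unit, ?_, by simpa using hi, by simpa using hj, ?_⟩
  · refine List.ext_getElem (by simp) fun k h₁ h₂ => ?_
    rw [List.getElem_map, List.getElem_set]
    split_ifs with hk
    · subst hk
      exact Units.ext hv
    · rw [List.getElem_map]
      exact hg _
  · rw [List.getElem_set_self, List.getElem_set_ne hij.symm]
    simp

lemma exists_lift_preProj_katoSpan [IsLocalRing A] (φ : A →+* B)
    (hφ : Function.Surjective φ) (r : ℕ) {z : PreK B} (hz : z ∈ katoSpan B) :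
    ∃ q ∈ katoSpan A ⊓ preGroup A r, preMap φ q = preProj B r z := by
  induction hz using AddSubgroup.closure_induction with
  | mem z hz =>
      obtain ⟨-, l, hlen, ⟨i, j, hi, hj, hij, hsum⟩, rfl⟩ := hz
      by_cases hr : l.length = r
      · subst hr
        rw [preProj_preSymbol_same]
        rcases subsingleton_or_nontrivial B with hB | hB
        · refine ⟨0, zero_mem _, ?_⟩
          rw [map_zero, preSymbol_eq_zero_of_subsingleton]
          rintro rfl
          simp at hlen
        · obtain ⟨m, rfl, hi, hj, hm⟩ := exists_lift_list φ hφ l hi hj hij hsum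
          rw [List.length_map] at hlen ⊢
          exact ⟨preSymbol m,
            ⟨AddSubgroup.subset_closure ⟨rfl, m, hlen, ⟨i, j, hi, hj, hij, hm⟩, rfl⟩,
              AddSubgroup.subset_closure ⟨m, rfl, rfl⟩⟩, preMap_preSymbol φ m⟩
      · exact ⟨0, zero_mem _, by rw [preProj_preSymbol_ne l hr, map_zero]⟩
  | zero => exact ⟨0, zero_mem _, by simp⟩
  | add x y _ _ hx hy =>
      obtain ⟨p, hp, hpx⟩ := hx
      obtain ⟨q, hq, hqy⟩ := hy
      exact ⟨p + q, add_mem hp hq, by rw [map_add, map_add, hpx, hqy]⟩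
  | neg x _ hx =>
      obtain ⟨p, hp, hpx⟩ := hx
      exact ⟨-p, neg_mem hp, by rw [map_neg, map_neg, hpx]⟩

lemma map_tToK_relTGroup [IsLocalRing A] (I : Ideal A) (r : ℕ) :
    AddSubgroup.map (tToK A).toAddMonoidHom (relTGroup A I r) = relKGroup A I r := by
  apply le_antisymm
  · rintro _ ⟨x, ⟨hx, hx0⟩, rfl⟩
    rw [← map_preGroup_tildeRel] at hx
    obtain ⟨p, hp, rfl⟩ := hx
    refine ⟨?_, ?_⟩
    · rw [← map_preGroup_katoRel]
      exact ⟨p, hp, (tToK_mk p).symm⟩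
    · have hx0 : tmap (Ideal.Quotient.mk I) (RingQuot.mkRingHom (tildeRel A) p) = 0 := hx0
      show kmap _ (tToK A (RingQuot.mkRingHom (tildeRel A) p)) = 0
      rw [kmap_tToK, hx0, map_zero]
  · rintro x ⟨hx, hx0⟩
    rw [← map_preGroup_katoRel] at hx
    obtain ⟨p, hp, rfl⟩ := hx
    have hx0 : kmap (Ideal.Quotient.mk I) (RingQuot.mkRingHom (katoRel A) p) = 0 := hx0
    rw [kmap_mk, mkRingHom_katoRel_eq_zero_iff] at hx0
    obtain ⟨q, ⟨hqN, hqr⟩, hq⟩ :=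
      exists_lift_preProj_katoSpan (Ideal.Quotient.mk I) Ideal.Quotient.mk_surjective r hx0
    rw [preProj_of_mem_preGroup (preMap_mem_preGroup _ hp)] at hq
    refine ⟨RingQuot.mkRingHom (tildeRel A) (p - q), ⟨?_, ?_⟩, ?_⟩
    · rw [← map_preGroup_tildeRel]
      exact ⟨p - q, sub_mem hp hqr, rfl⟩
    · show tmap _ (RingQuot.mkRingHom (tildeRel A) (p - q)) = 0
      rw [tmap_mk, map_sub, hq, sub_self, map_zero]
    · show tToK A (RingQuot.mkRingHom (tildeRel A) (p - q)) =
        RingQuot.mkRingHom (katoRel A) p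
      rw [tToK_mk, map_sub, mkRingHom_katoRel_eq_zero_iff.2 hqN, sub_zero]

end functoriality

section anticommutativity

variable {A : Type*} [CommRing A]

/-- The degree-one symbol `{a}` in the weak Milnor ring. -/
def tunit (a : Aˣ) : TRing A :=
  RingQuot.mkRingHom _ (TensorAlgebra.ι ℤ (Additive.ofMul a))

lemma tunit_mul (a b : Aˣ) : tunit (a * b) = tunit a + tunit b := by
  simp [tunit]

lemma tunit_inv (a : Aˣ) : tunit a⁻¹ = -tunit a := by
  simp [tunit]

lemma tring_neg_mul (x y : TRing A) : -x * y = -(x * y) :=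
  neg_mul x y

lemma tring_mul_neg (x y : TRing A) : x * -y = -(x * y) :=
  mul_neg x y

lemma tsymbol_cons (a : Aˣ) (l : List Aˣ) : tsymbol (a :: l) = tunit a * tsymbol l := by
  simp [tsymbol, preSymbol, tunit]

lemma tunit_mul_tunit_of_add_eq_one {a b : Aˣ} (h : (a : A) + b = 1) :
    tunit a * tunit b = 0 := by
  have h0 : RingQuot.mkRingHom (tildeRel A) (preSymbol [a, b]) = 0 :=
    (RingQuot.mkRingHom_rel ⟨rfl, a, b, h, rfl⟩).trans (map_zero _)
  simpa [preSymbol, tunit] using h0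

lemma tunit_mul_tunit_neg_of_isUnit_one_sub {a : Aˣ} (h : IsUnit (1 - (a : A))) :
    tunit a * tunit (-a) = 0 := by
  obtain ⟨b, hb⟩ := h
  have hab : (a : A) + b = 1 := by rw [hb]; ring
  have hc : ((a⁻¹ : Aˣ) : A) + (-(b * a⁻¹) : Aˣ) = 1 := by
    push_cast
    rw [hb, sub_mul, one_mul, Units.mul_inv]
    ring
  have h₁ := tunit_mul_tunit_of_add_eq_one hab
  have h₂ := tunit_mul_tunit_of_add_eq_one hc
  rw [tunit_inv, tring_neg_mul, neg_eq_zero] at h₂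
  have hneg : -a = b * (-(b * a⁻¹))⁻¹ := by
    rw [inv_neg, mul_neg, mul_inv_rev, inv_inv, mul_comm a, mul_inv_cancel_left]
  rw [hneg, tunit_mul, tunit_inv, mul_add, tring_mul_neg, h₁, h₂, neg_zero, add_zero]

lemma tunit_mul_mul_tunit_neg_mul (a b : Aˣ) :
    tunit (a * b) * tunit (-(a * b)) =
      tunit a * tunit (-a) + tunit b * tunit (-b) +
        (tunit a * tunit b + tunit b * tunit a) := by
  have h₁ : tunit (-(a * b)) = tunit (-a) + tunit b := by rw [← tunit_mul, neg_mul]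
  have h₂ : tunit (-(a * b)) = tunit a + tunit (-b) := by rw [← tunit_mul, mul_neg]
  rw [tunit_mul, add_mul]
  nth_rewrite 1 [h₁]
  rw [h₂, mul_add, mul_add]
  abel

lemma tunit_mul_tunit_neg [IsLocalRing A] [Infinite (IsLocalRing.ResidueField A)] (a : Aˣ) :
    tunit a * tunit (-a) = 0 := by
  classical
  have hunit : ∀ {x : A}, IsLocalRing.residue A x ≠ 1 → IsUnit (1 - x) := fun {x} hx => by
    rw [← IsLocalRing.residue_ne_zero_iff_isUnit, map_sub, map_one]
    exact sub_ne_zero.2 hx.symm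
  have exists_unit : ∀ S : Finset (IsLocalRing.ResidueField A),
      ∃ s : Aˣ, IsLocalRing.residue A s ∉ S := fun S => by
    obtain ⟨x, hx⟩ := Infinite.exists_notMem_finset (insert 0 S)
    obtain ⟨y, rfl⟩ := IsLocalRing.residue_surjective x
    simp only [Finset.mem_insert, not_or] at hx
    obtain ⟨s, rfl⟩ := (IsLocalRing.residue_ne_zero_iff_isUnit y).1 hx.1
    exact ⟨s, hx.2⟩
  by_cases ha : IsLocalRing.residue A a = 1
  · have key : ∀ s : Aˣ, IsLocalRing.residue A s ≠ 1 →
        tunit a * tunit (-a) = -(tunit a * tunit s + tunit s * tunit a) := fun s hs => by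
      have h := tunit_mul_mul_tunit_neg_mul a s
      rw [tunit_mul_tunit_neg_of_isUnit_one_sub (hunit hs),
        tunit_mul_tunit_neg_of_isUnit_one_sub (hunit (by simpa [ha] using hs)),
        add_zero] at h
      exact eq_neg_of_add_eq_zero_left h.symm
    obtain ⟨s, hs⟩ := exists_unit {1}
    obtain ⟨t, ht⟩ := exists_unit {1, (IsLocalRing.residue A s)⁻¹}
    simp only [Finset.mem_singleton, Finset.mem_insert, not_or] at hs ht
    have hst : IsLocalRing.residue A (s * t : Aˣ) ≠ 1 := fun h =>
      ht.2 (eq_inv_of_mul_eq_one_right (by simpa using h))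
    have h := key (s * t) hst
    rw [tunit_mul, mul_add, add_mul] at h
    have h' : tunit a * tunit (-a) = tunit a * tunit (-a) + tunit a * tunit (-a) := by
      nth_rewrite 2 [key s hs]
      nth_rewrite 2 [key t ht.1]
      rw [h]
      abel
    exact left_eq_add.1 h'
  · exact tunit_mul_tunit_neg_of_isUnit_one_sub (hunit ha)

lemma tunit_anticomm [IsLocalRing A] [Infinite (IsLocalRing.ResidueField A)] (a b : Aˣ) :
    tunit a * tunit b = -(tunit b * tunit a) := by
  have h := tunit_mul_mul_tunit_neg_mul a b
  simp only [tunit_mul_tunit_neg, zero_add] at h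
  exact eq_neg_of_add_eq_zero_left h.symm

lemma tunit_mul_tsymbol_of_mem [IsLocalRing A] [Infinite (IsLocalRing.ResidueField A)]
    {a b : Aˣ} (h : (a : A) + b = 1) {l : List Aˣ} (hb : b ∈ l) :
    tunit a * tsymbol l = 0 := by
  induction l with
  | nil => simp at hb
  | cons c l ih =>
      rw [tsymbol_cons, ← mul_assoc]
      rcases List.mem_cons.1 hb with rfl | hb
      · rw [tunit_mul_tunit_of_add_eq_one h, zero_mul]
      · rw [tunit_anticomm, tring_neg_mul, mul_assoc, ih hb, mul_zero, neg_zero]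

lemma tsymbol_eq_zero_of_lt [IsLocalRing A] [Infinite (IsLocalRing.ResidueField A)]
    (l : List Aˣ) {i j : ℕ} (hij : i < j) (hj : j < l.length)
    (h : (l[i] : A) + (l[j] : A) = 1) : tsymbol l = 0 := by
  induction l generalizing i j with
  | nil => simp at hj
  | cons c l ih =>
      obtain ⟨j, rfl⟩ := Nat.exists_eq_add_one_of_ne_zero (Nat.ne_zero_of_lt hij)
      rw [tsymbol_cons]
      cases i with
      | zero => exact tunit_mul_tsymbol_of_mem h (List.getElem_mem _)
      | succ i => rw [ih (Nat.lt_of_succ_lt_succ hij) (Nat.lt_of_succ_lt_succ hj) h, mul_zero]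

/-- The canonical map from the weak Milnor ring to Kato's Milnor ring is injective for a local
ring with infinite residue field. -/
lemma tToK_injective [IsLocalRing A] [Infinite (IsLocalRing.ResidueField A)] :
    Function.Injective (tToK A) := by
  have hrel : ∀ ⦃x y : PreK A⦄, katoRel A x y →
      RingQuot.mkRingHom (tildeRel A) x = RingQuot.mkRingHom (tildeRel A) y := by
    rintro x y ⟨rfl, l, -, ⟨i, j, hi, hj, hij, hsum⟩, rfl⟩
    rw [map_zero]
    rcases lt_or_gt_of_ne hij with hlt | hlt
    · exact tsymbol_eq_zero_of_lt l hlt hj hsum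
    · exact tsymbol_eq_zero_of_lt l hlt hi (by rwa [add_comm])
  refine Function.LeftInverse.injective (g := RingQuot.lift ⟨_, hrel⟩) fun x => ?_
  obtain ⟨x, rfl⟩ := RingQuot.mkRingHom_surjective _ x
  rw [tToK_mk, RingQuot.lift_mkRingHom_apply]

end anticommutativity

end MilnorKTheory

open MilnorKTheory in
/-- Let `A` be a local ring, `I ⊆ A` an ideal and `r ≥ 1`.  Then the
canonical map `K̃^M_r(A,I) → K^M_r(A,I)` is surjective, and it is an isomorphism (i.e. moreover
injective on `K̃^M_r(A,I)`) if the residue field of `A` is infinite. -/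
theorem relTGroup_to_relKGroup_surjective_and_injective
    (A : Type*) [CommRing A] [IsLocalRing A] (I : Ideal A) (r : ℕ) (hr : 1 ≤ r) :
    AddSubgroup.map (tToK A).toAddMonoidHom (relTGroup A I r) = relKGroup A I r ∧
    (Infinite (IsLocalRing.ResidueField A) →
      Set.InjOn (tToK A) (relTGroup A I r)) := by
  exact ⟨map_tToK_relTGroup I r, fun _ => tToK_injective.injOn⟩
end

section
/- Let A be a local domain with fraction field F and let I = (f) be the principal ideal generated by a nonzero element f ∈ A. Let A_f = A[1/f] be the localization. For r ≥ 1 let E_r(A,I) ⊆ K^M_r(F) be the image of the canonical map K^M_r(A,I) → K^M_r(F), let K̂^M_1(A|I) ⊆ K^M_1(F) = F^× be the image of K^M_1(A,I) = ker(A^× → (A/I)^×), and for r ≥ 2 let K̂^M_r(A|I) ⊆ K^M_r(F) be the image of the product map K^M_1(A,I) ⊗ (A_f)^× ⊗ ⋯ ⊗ (A_f)^× → K^M_r(F) (with r−1 factors (A_f)^×), sending u ⊗ v_2 ⊗ ⋯ ⊗ v_r to the Milnor symbol {u, v_2, …, v_r}. Then E_r(A,I) ⊆ K̂^M_r(A|I),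 and this inclusion is an equality if I is a prime ideal of A. -/
namespace MilnorKTheory

section fraction

variable (A : Type*) [CommRing A] [IsDomain A]

/-- The localization `A_g = A[1/g]`, realized as the subring of the fraction field `F` of `A`
generated by (the image of) `A` together with `1/g`. -/
def awaySubring (g : A) : Subring (FractionRing A) :=
  Subring.closure
    (Set.range (algebraMap A (FractionRing A)) ∪ {(algebraMap A (FractionRing A) g)⁻¹})

/-- The predicate on a unit `v` of the fraction field `F` of `A` saying that `v` is in the image
of `(A_g)^× → F^×`, i.e. both `v` and `v⁻¹` lie in the subring `A_g ⊆ F`. -/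
def memAwayUnits (g : A) (v : (FractionRing A)ˣ) : Prop :=
  ((v : FractionRing A) ∈ awaySubring A g) ∧
    (((v⁻¹ : (FractionRing A)ˣ) : FractionRing A) ∈ awaySubring A g)

/-- The subgroup `K̂^M_r(A|J) ⊆ K^M_r(F)` (for `J` and the localization at `g`): the image of
the product map `K^M_1(A,J) ⊗ (A_g)^× ⊗ ⋯ ⊗ (A_g)^× → K^M_r(F)` (with `r - 1` factors
`(A_g)^×`), i.e. the additive subgroup generated by the Milnor symbols `{u, v₂, …, v_r}` with
`u ∈ ker(A^× → (A/J)^×)` and `v₂, …, v_r ∈ (A_g)^×`. -/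
def hatKGroup (g : A) (J : Ideal A) (r : ℕ) : AddSubgroup (KRing (FractionRing A)) :=
  AddSubgroup.closure
    { x | ∃ u : Aˣ, ((u : A) - 1 ∈ J) ∧ ∃ v : List (FractionRing A)ˣ,
        v.length = r - 1 ∧ (∀ w ∈ v, memAwayUnits A g w) ∧
        x = ksymbol ((Units.map ((algebraMap A (FractionRing A)) : A →* FractionRing A) u) :: v) }

/-- The subgroup `E_r(A,J) ⊆ K^M_r(F)`: the image of the canonical map
`K^M_r(A,J) → K^M_r(F)`. -/
def eGroup (J : Ideal A) (r : ℕ) : AddSubgroup (KRing (FractionRing A)) :=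
  AddSubgroup.map (kmap (algebraMap A (FractionRing A))).toAddMonoidHom (relKGroup A J r)

end fraction

end MilnorKTheory

namespace MilnorKTheory

/-- Products of elements of additive closures lie in an additive subgroup as soon as the
products of the generators do. -/
lemma mul_mem_of_mem_closure {R : Type*} [Ring R] {S T : Set R} {U : AddSubgroup R}
    (h : ∀ x ∈ S, ∀ y ∈ T, x * y ∈ U) {x y : R} (hx : x ∈ AddSubgroup.closure S)
    (hy : y ∈ AddSubgroup.closure T) : x * y ∈ U := by
  induction hx using AddSubgroup.closure_induction with
  | mem x hx =>
    induction hy using AddSubgroup.closure_induction with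
    | mem y hy => exact h x hx y hy
    | zero => rw [mul_zero]; exact zero_mem _
    | add a b _ _ ha hb => rw [mul_add]; exact add_mem ha hb
    | neg a _ ha => rw [mul_neg]; exact neg_mem ha
  | zero => rw [zero_mul]; exact zero_mem _
  | add a b _ _ ha hb => rw [add_mul]; exact add_mem ha hb
  | neg a _ ha => rw [neg_mul]; exact neg_mem ha

section symbols

variable {A B : Type*} [CommRing A] [CommRing B]

/-- The degree-one symbol `{a}` as an additive homomorphism. -/
noncomputable def unitSymbol (A : Type*) [CommRing A] : Additive Aˣ →+ KRing A :=
  (RingQuot.mkRingHom (katoRel A)).toAddMonoidHom.comp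
    (TensorAlgebra.ι ℤ : Additive Aˣ →ₗ[ℤ] PreK A).toAddMonoidHom

lemma ksymbol_nil : ksymbol ([] : List Aˣ) = 1 := map_one _

lemma ksymbol_cons (a : Aˣ) (l : List Aˣ) :
    ksymbol (a :: l) = unitSymbol A (.ofMul a) * ksymbol l := map_mul _ _ _

lemma ksymbol_singleton (a : Aˣ) : ksymbol [a] = unitSymbol A (.ofMul a) := by
  rw [ksymbol_cons, ksymbol_nil, mul_one]

lemma ksymbol_append (l l' : List Aˣ) : ksymbol (l ++ l') = ksymbol l * ksymbol l' := by
  induction l with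
  | nil => rw [ksymbol_nil, one_mul, List.nil_append]
  | cons a l ih => rw [List.cons_append, ksymbol_cons, ksymbol_cons, ih, mul_assoc]

lemma unitSymbol_mul (a b : Aˣ) : unitSymbol A (.ofMul (a * b)) =
    unitSymbol A (.ofMul a) + unitSymbol A (.ofMul b) := map_add (unitSymbol A) _ _

lemma unitSymbol_one : unitSymbol A (.ofMul 1) = 0 := map_zero (unitSymbol A)

lemma unitSymbol_inv (a : Aˣ) : unitSymbol A (.ofMul a⁻¹) = -unitSymbol A (.ofMul a) :=
  map_neg (unitSymbol A) _

lemma ksymbol_eq_zero (l : List Aˣ) (i j : ℕ) (hi : i < l.length) (hj : j < l.length)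
    (hij : i ≠ j) (h : (l[i] : A) + (l[j] : A) = 1) : ksymbol l = 0 :=
  (RingQuot.mkRingHom_rel ⟨rfl, l, by omega, ⟨i, j, hi, hj, hij, h⟩, rfl⟩).trans (map_zero _)

/-- The Steinberg relation `{a}{b} = 0` for `a + b = 1`. -/
lemma unitSymbol_mul_unitSymbol_eq_zero (a b : Aˣ) (h : (a : A) + b = 1) :
    unitSymbol A (.ofMul a) * unitSymbol A (.ofMul b) = 0 := by
  rw [← ksymbol_singleton b, ← ksymbol_cons]
  exact ksymbol_eq_zero [a, b] 0 1 (by simp) (by simp) (by simp) (by simpa using h)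

lemma kmap_ksymbol (φ : A →+* B) (l : List Aˣ) :
    kmap φ (ksymbol l) = ksymbol (l.map (Units.map (φ : A →* B))) := by
  rw [ksymbol, ksymbol, ← preMap_preSymbol, kmap, RingQuot.lift_mkRingHom_apply]
  rfl

/-- The Milnor ring is additively generated by symbols. -/
lemma closure_range_ksymbol : AddSubgroup.closure (Set.range (ksymbol (A := A))) = ⊤ := by
  set S := AddSubgroup.closure (Set.range (ksymbol (A := A)))
  have hmul : ∀ x ∈ S, ∀ y ∈ S, x * y ∈ S := by
    intro x hx y hy
    refine mul_mem_of_mem_closure ?_ hx hy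
    rintro _ ⟨l, rfl⟩ _ ⟨l', rfl⟩
    exact AddSubgroup.subset_closure ⟨l ++ l', ksymbol_append l l'⟩
  rw [eq_top_iff]
  rintro x -
  obtain ⟨x, rfl⟩ := RingQuot.mkRingHom_surjective _ x
  induction x using TensorAlgebra.induction with
  | algebraMap n =>
    rw [eq_intCast, map_intCast, ← zsmul_one]
    exact S.zsmul_mem (AddSubgroup.subset_closure ⟨[], ksymbol_nil⟩) n
  | ι a => exact AddSubgroup.subset_closure ⟨[a.toMul], ksymbol_singleton a.toMul⟩
  | mul a b ha hb => rw [map_mul]; exact hmul _ ha _ hb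
  | add a b ha hb => rw [map_add]; exact S.add_mem ha hb

/-- Additive maps out of the Milnor ring are determined on symbols. -/
lemma addMonoidHom_ext_ksymbol {M : Type*} [AddGroup M] {f g : KRing A →+ M}
    (h : ∀ l, f (ksymbol l) = g (ksymbol l)) : f = g := by
  refine AddMonoidHom.eq_of_eqOn_dense closure_range_ksymbol ?_
  rintro _ ⟨l, rfl⟩
  exact h l

/-- The universal property of the Milnor ring. -/
lemma exists_ringHom_ksymbol {R : Type*} [Ring R] (φ : Additive Aˣ →+ R)
    (h : ∀ (l : List Aˣ) (i j : ℕ) (hi : i < l.length) (hj : j < l.length), i ≠ j →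
      (l[i] : A) + (l[j] : A) = 1 → (l.map fun a => φ (.ofMul a)).prod = 0) :
    ∃ ψ : KRing A →+* R, ∀ l, ψ (ksymbol l) = (l.map fun a => φ (.ofMul a)).prod := by
  have hpre : ∀ l : List Aˣ, TensorAlgebra.lift ℤ φ.toIntLinearMap (preSymbol l) =
      (l.map fun a => φ (.ofMul a)).prod := by
    intro l
    induction l with
    | nil => exact map_one _
    | cons a l ih =>
      rw [preSymbol, map_mul, TensorAlgebra.lift_ι_apply, ih, List.map_cons, List.prod_cons]
      rfl
  refine ⟨RingQuot.lift ⟨(TensorAlgebra.lift ℤ φ.toIntLinearMap).toRingHom, ?_⟩, fun l => ?_⟩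
  · rintro _ _ ⟨rfl, l, -, ⟨i, j, hi, hj, hij, hsum⟩, rfl⟩
    rw [map_zero]
    exact (hpre l).trans (h l i j hi hj hij hsum)
  · rw [ksymbol, RingQuot.lift_mkRingHom_apply]
    exact hpre l

/-- The projection of the Milnor ring onto its degree-`r` part. -/
lemma exists_degree_projection (A : Type*) [CommRing A] (r : ℕ) :
    ∃ p : KRing A →+ KRing A, ∀ l : List Aˣ,
      p (ksymbol l) = if l.length = r then ksymbol l else 0 := by
  let φ : Additive Aˣ →+ Polynomial (KRing A) :=
    (Polynomial.monomial 1).toAddMonoidHom.comp (unitSymbol A)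
  have hφ : ∀ l : List Aˣ,
      (l.map fun a => φ (.ofMul a)).prod = Polynomial.monomial l.length (ksymbol l) := by
    intro l
    induction l with
    | nil => simp [ksymbol_nil]
    | cons a l ih =>
      rw [List.map_cons, List.prod_cons, ih, ksymbol_cons, List.length_cons, add_comm]
      exact Polynomial.monomial_mul_monomial _ _ _ _
  obtain ⟨ψ, hψ⟩ := exists_ringHom_ksymbol φ fun l i j hi hj hij hsum => by
    rw [hφ, ksymbol_eq_zero l i j hi hj hij hsum, map_zero]
  refine ⟨(Polynomial.lcoeff (KRing A) r).toAddMonoidHom.comp ψ.toAddMonoidHom, fun l => ?_⟩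
  change (ψ (ksymbol l)).coeff r = _
  rw [hψ, hφ, Polynomial.coeff_monomial]

end symbols

section kernel

variable {A B : Type*} [CommRing A] [CommRing B]

/-- The symbols with an entry that is trivial under `φ`. -/
def relativeSymbols (φ : A →+* B) : Set (KRing A) :=
  { x | ∃ l : List Aˣ, (∃ u ∈ l, φ u = 1) ∧ x = ksymbol l }

/-- The two-sided ideal additively generated by the symbols with an entry that is trivial
under `φ`. -/
noncomputable def relativeIdeal (φ : A →+* B) : TwoSidedIdeal (KRing A) :=
  .mk' (AddSubgroup.closure (relativeSymbols φ)) (AddSubgroup.zero_mem _)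
    (AddSubgroup.add_mem _) (AddSubgroup.neg_mem _)
    (fun {x y} hy => mul_mem_of_mem_closure
      (by
        rintro _ ⟨l, rfl⟩ _ ⟨l', ⟨u, hu, hu1⟩, rfl⟩
        exact AddSubgroup.subset_closure
          ⟨l ++ l', ⟨u, List.mem_append_right l hu, hu1⟩, (ksymbol_append l l').symm⟩)
      (closure_range_ksymbol.ge (AddSubgroup.mem_top x)) hy)
    (fun {x y} hx => mul_mem_of_mem_closure
      (by
        rintro _ ⟨l, ⟨u, hu, hu1⟩, rfl⟩ _ ⟨l', rfl⟩
        exact AddSubgroup.subset_closure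
          ⟨l ++ l', ⟨u, List.mem_append_left l' hu, hu1⟩, (ksymbol_append l l').symm⟩)
      hx (closure_range_ksymbol.ge (AddSubgroup.mem_top y)))

lemma mem_relativeIdeal (φ : A →+* B) (x : KRing A) :
    x ∈ relativeIdeal φ ↔ x ∈ AddSubgroup.closure (relativeSymbols φ) :=
  TwoSidedIdeal.mem_mk' ..

/-- For a local surjection `φ`, the kernel of `K^M_*(φ)` is generated by the symbols with an
entry that is trivial under `φ`. -/
lemma mem_relativeIdeal_of_kmap_eq_zero (φ : A →+* B) [IsLocalHom φ]
    (hφ : Function.Surjective φ) {x : KRing A} (hx : kmap φ x = 0) : x ∈ relativeIdeal φ := by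
  let q := (relativeIdeal φ).ringCon.mk'
  have hq : ∀ {x}, q x = 0 ↔ x ∈ relativeIdeal φ := fun {x} => by
    rw [TwoSidedIdeal.mem_iff, ← RingCon.eq, ← map_zero q]
    rfl
  have hsurj : Function.Surjective (Units.map (φ : A →* B)) :=
    IsLocalRing.surjective_units_map_of_local_ringHom φ hφ inferInstance
  let π : Additive Aˣ →+ Additive Bˣ := MonoidHom.toAdditive (Units.map (φ : A →* B))
  let g : Additive Bˣ →+ (relativeIdeal φ).ringCon.Quotient :=
    π.liftOfSurjective hsurj ⟨q.toAddMonoidHom.comp (unitSymbol A), fun a ha => by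
      refine hq.2 ((mem_relativeIdeal φ _).2 (AddSubgroup.subset_closure
        ⟨[a.toMul], ⟨a.toMul, by simp, ?_⟩, (ksymbol_singleton _).symm⟩))
      exact congrArg (fun u : Additive Bˣ => (u.toMul : B)) ha⟩
  have hg : ∀ l : List Aˣ,
      ((l.map (Units.map (φ : A →* B))).map fun b => g (.ofMul b)).prod = q (ksymbol l) := by
    intro l
    induction l with
    | nil => simp [ksymbol_nil]
    | cons a l ih =>
      rw [List.map_cons, List.map_cons, List.prod_cons, ih, ksymbol_cons, map_mul]
      congr 1
      exact AddMonoidHom.liftOfRightInverse_comp_apply π _ _ _ (.ofMul a)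
  obtain ⟨ψ, hψ⟩ := exists_ringHom_ksymbol g fun l i j hi hj hij hsum => by
    obtain ⟨l, rfl⟩ := List.map_surjective_iff.2 hsurj l
    rw [List.length_map] at hi hj
    simp only [List.getElem_map, Units.coe_map, MonoidHom.coe_coe] at hsum
    obtain ⟨b, hb⟩ : IsUnit (1 - (l[i] : A)) := by
      refine isUnit_of_map_unit φ _ ?_
      rw [map_sub, map_one, ← hsum, add_sub_cancel_left]
      exact l[j].isUnit.map φ
    have hset : (l.set j b).map (Units.map (φ : A →* B)) = l.map (Units.map (φ : A →* B)) := by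
      refine List.ext_getElem (by simp) fun k hk hk' => ?_
      rw [List.getElem_map, List.getElem_map, List.getElem_set]
      split_ifs with hjk
      · subst hjk
        ext
        simp only [Units.coe_map, MonoidHom.coe_coe, hb]
        rw [map_sub, map_one, ← hsum, add_sub_cancel_left]
      · rfl
    rw [← hset, hg, ksymbol_eq_zero (l.set j b) i j (by simpa) (by simpa) hij, map_zero]
    rw [List.getElem_set_ne hij.symm, List.getElem_set_self, hb, add_sub_cancel]
  have hcomp : ψ.toAddMonoidHom.comp (kmap φ).toAddMonoidHom = q.toAddMonoidHom :=
    addMonoidHom_ext_ksymbol fun l => by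
      change ψ (kmap φ (ksymbol l)) = q (ksymbol l)
      rw [kmap_ksymbol, hψ, hg]
  refine hq.1 ((DFunLike.congr_fun hcomp x).symm.trans ?_)
  change ψ (kmap φ x) = 0
  rw [hx, map_zero]

/-- Over a local ring, `K^M_r(A, I)` is generated by the symbols of length `r` with an entry
congruent to `1` modulo `I`. -/
lemma relKGroup_le_closure [IsLocalRing A] (I : Ideal A) {r : ℕ} (hr : 1 ≤ r) :
    relKGroup A I r ≤ AddSubgroup.closure
      { x | ∃ l : List Aˣ, l.length = r ∧ (∃ u ∈ l, (u : A) - 1 ∈ I) ∧ x = ksymbol l } := by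
  rintro x ⟨hx, hx0⟩
  by_cases hI : I = ⊤
  · refine AddSubgroup.closure_mono ?_ hx
    rintro _ ⟨l, hl, rfl⟩
    exact ⟨l, hl, ⟨l[0], List.getElem_mem (by omega), hI ▸ Submodule.mem_top⟩, rfl⟩
  have : Nontrivial (A ⧸ I) := Ideal.Quotient.nontrivial_iff.2 hI
  have : IsLocalHom (Ideal.Quotient.mk I) := .of_surjective _ Ideal.Quotient.mk_surjective
  obtain ⟨p, hp⟩ := exists_degree_projection A r
  have hpx : Set.EqOn p (AddMonoidHom.id _) (KGroup A r) := by
    refine AddMonoidHom.eqOn_closure ?_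
    rintro _ ⟨l, hl, rfl⟩
    exact (hp l).trans (if_pos hl)
  rw [← AddMonoidHom.id_apply (KRing A) x, ← hpx hx]
  have hxc := (mem_relativeIdeal _ _).1
    (mem_relativeIdeal_of_kmap_eq_zero _ Ideal.Quotient.mk_surjective hx0)
  rw [← AddSubgroup.mem_comap]
  refine (AddSubgroup.closure_le _).2 ?_ hxc
  rintro _ ⟨l, ⟨u, hu, hu1⟩, rfl⟩
  rw [SetLike.mem_coe, AddSubgroup.mem_comap, hp]
  split_ifs with hl
  · refine AddSubgroup.subset_closure ⟨l, hl, ⟨u, hu, ?_⟩, rfl⟩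
    rw [← Ideal.Quotient.eq, hu1, map_one]
  · exact zero_mem _

end kernel

end MilnorKTheory

namespace MilnorKTheory

section field

variable {F : Type*} [Field F]

lemma unitSymbol_mul_unitSymbol_neg (a : Fˣ) :
    unitSymbol F (.ofMul a) * unitSymbol F (.ofMul (-a)) = 0 := by
  by_cases ha : (a : F) = 1
  · rw [Units.val_eq_one.1 ha, unitSymbol_one, zero_mul]
  have ha0 : (a : F) ≠ 0 := a.ne_zero
  let b : Fˣ := Units.mk0 (1 - (a : F)) (sub_ne_zero.2 (Ne.symm ha))
  let c : Fˣ := Units.mk0 (1 - (a : F)⁻¹) (sub_ne_zero.2 (Ne.symm (inv_ne_one.2 ha)))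
  have hbc : -a * c = b := by
    ext
    simp only [b, c, Units.val_mul, Units.val_neg, Units.val_mk0]
    field_simp
    ring
  have hb := unitSymbol_mul_unitSymbol_eq_zero a b (by simp [b])
  have hc := unitSymbol_mul_unitSymbol_eq_zero a⁻¹ c (by simp [c])
  have hc' := add_mul (unitSymbol F (.ofMul a)) (unitSymbol F (.ofMul a⁻¹))
    (unitSymbol F (.ofMul c))
  rw [← unitSymbol_mul, mul_inv_cancel, unitSymbol_one, zero_mul, hc, add_zero] at hc'
  rwa [← hbc, unitSymbol_mul, mul_add, ← hc', add_zero] at hb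

/-- Symbols over a field anticommute. -/
lemma unitSymbol_mul_comm (a b : Fˣ) :
    unitSymbol F (.ofMul a) * unitSymbol F (.ofMul b) =
      -(unitSymbol F (.ofMul b) * unitSymbol F (.ofMul a)) := by
  have h := unitSymbol_mul_unitSymbol_neg (a * b)
  have ha : -(a * b) = -a * b := (neg_mul a b).symm
  have hb : -(a * b) = -b * a := by rw [neg_mul, mul_comm]
  rw [unitSymbol_mul, add_mul] at h
  nth_rw 1 [ha] at h
  rw [hb, unitSymbol_mul, unitSymbol_mul, mul_add, mul_add, unitSymbol_mul_unitSymbol_neg,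
    unitSymbol_mul_unitSymbol_neg, zero_add, zero_add] at h
  exact eq_neg_of_add_eq_zero_left h

lemma unitSymbol_mul_left_comm (a b : Fˣ) (x : KRing F) :
    unitSymbol F (.ofMul a) * (unitSymbol F (.ofMul b) * x) =
      -(unitSymbol F (.ofMul b) * (unitSymbol F (.ofMul a) * x)) := by
  rw [← mul_assoc, unitSymbol_mul_comm, ← mul_assoc]
  exact neg_mul (unitSymbol F (.ofMul b) * unitSymbol F (.ofMul a)) x

/-- An entry of a symbol can be moved to the front up to sign. -/
lemma ksymbol_append_cons (s t : List Fˣ) (u : Fˣ) :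
    ksymbol (s ++ u :: t) = ksymbol (u :: (s ++ t)) ∨
      ksymbol (s ++ u :: t) = -ksymbol (u :: (s ++ t)) := by
  induction s with
  | nil => exact .inl rfl
  | cons a s ih =>
    simp only [List.cons_append, ksymbol_cons] at ih ⊢
    rw [unitSymbol_mul_left_comm u a]
    rcases ih with ih | ih
    · exact .inr (by rw [ih, neg_neg])
    · exact .inl (by rw [ih]; exact mul_neg (unitSymbol F (.ofMul a)) _)

end field

section fraction

variable (A : Type*) [CommRing A]

/-- The map `A^× → F^×` to the units of the fraction field. -/
noncomputable abbrev unitsToFrac : Aˣ →* (FractionRing A)ˣ :=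
  Units.map ((algebraMap A (FractionRing A)) : A →* FractionRing A)

variable {A}

/-- The degree-one symbol in `K^M_1(F)` of a unit of `A`. -/
noncomputable abbrev fracSymbol (a : Aˣ) : KRing (FractionRing A) :=
  unitSymbol (FractionRing A) (.ofMul (unitsToFrac A a))

lemma fracSymbol_mul_mem_eGroup {I : Ideal A} {r : ℕ} (w : Aˣ) {x : KRing (FractionRing A)}
    (hx : x ∈ eGroup A I r) : fracSymbol w * x ∈ eGroup A I (r + 1) := by
  obtain ⟨y, ⟨hy, hy0⟩, rfl⟩ := hx
  refine ⟨unitSymbol A (.ofMul w) * y, ⟨?_, ?_⟩, ?_⟩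
  · refine mul_mem_of_mem_closure ?_ (AddSubgroup.mem_closure_singleton_self _) hy
    rintro _ rfl _ ⟨l, hl, rfl⟩
    exact AddSubgroup.subset_closure ⟨w :: l, by simp [hl], (ksymbol_cons w l).symm⟩
  · change kmap _ _ = 0
    rw [map_mul, show kmap (Ideal.Quotient.mk I) y = 0 from hy0, mul_zero]
  · change kmap _ _ = fracSymbol w * kmap _ _
    rw [map_mul, ← ksymbol_singleton, kmap_ksymbol, List.map_singleton, ksymbol_singleton]

lemma fracSymbol_mem_eGroup {I : Ideal A} {u : Aˣ} (hu : (u : A) - 1 ∈ I) :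
    fracSymbol u ∈ eGroup A I 1 := by
  refine ⟨ksymbol [u], ⟨AddSubgroup.subset_closure ⟨[u], rfl, rfl⟩, ?_⟩, ?_⟩
  · change kmap _ _ = 0
    have h1 : Units.map (Ideal.Quotient.mk I : A →* A ⧸ I) u = 1 :=
      Units.ext ((Ideal.Quotient.eq.2 hu).trans (map_one _))
    rw [kmap_ksymbol, List.map_singleton, ksymbol_singleton, h1, unitSymbol_one]
  · change kmap _ _ = _
    rw [kmap_ksymbol, List.map_singleton, ksymbol_singleton]

variable [IsDomain A]

lemma memAwayUnits_unitsToFrac (f : A) (a : Aˣ) : memAwayUnits A f (unitsToFrac A a) := by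
  refine ⟨Subring.subset_closure (.inl ⟨a, rfl⟩), ?_⟩
  rw [← map_inv]
  exact Subring.subset_closure (.inl ⟨(a⁻¹ : Aˣ), rfl⟩)

lemma eGroup_le_hatKGroup_of_one_le [IsLocalRing A] (f : A) (I : Ideal A) {r : ℕ} (hr : 1 ≤ r) :
    eGroup A I r ≤ hatKGroup A f I r := by
  refine (AddSubgroup.map_mono (relKGroup_le_closure I hr)).trans ?_
  rw [AddMonoidHom.map_closure, AddSubgroup.closure_le]
  rintro _ ⟨_, ⟨l, hl, ⟨u, hu, huI⟩, rfl⟩, rfl⟩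
  obtain ⟨s, t, rfl⟩ := List.append_of_mem hu
  have hmem : ksymbol (unitsToFrac A u :: (s.map (unitsToFrac A) ++ t.map (unitsToFrac A))) ∈
      hatKGroup A f I r := by
    refine AddSubgroup.subset_closure ⟨u, huI, _, ?_, ?_, rfl⟩
    · simp at hl ⊢
      omega
    · rw [← List.map_append]
      rintro _ hw
      obtain ⟨a, -, rfl⟩ := List.mem_map.1 hw
      exact memAwayUnits_unitsToFrac f a
  change kmap _ _ ∈ hatKGroup A f I r
  rw [kmap_ksymbol, List.map_append, List.map_cons]
  rcases ksymbol_append_cons (s.map (unitsToFrac A)) (t.map (unitsToFrac A)) (unitsToFrac A u)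
    with h | h
  · rw [h]; exact hmem
  · rw [h]; exact neg_mem hmem

lemma exists_mul_pow_eq_of_mem_awaySubring {f : A} (hf : f ≠ 0) {y : FractionRing A}
    (hy : y ∈ awaySubring A f) :
    ∃ (n : ℕ) (a : A), y * algebraMap A (FractionRing A) f ^ n =
      algebraMap A (FractionRing A) a := by
  have hf' : algebraMap A (FractionRing A) f ≠ 0 := by simpa using hf
  induction hy using Subring.closure_induction with
  | mem y hy =>
    rcases hy with ⟨a, rfl⟩ | rfl
    · exact ⟨0, a, by simp⟩
    · exact ⟨1, 1, by simp [hf']⟩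
  | zero => exact ⟨0, 0, by simp⟩
  | one => exact ⟨0, 1, by simp⟩
  | add x y _ _ hx hy =>
    obtain ⟨n, a, ha⟩ := hx
    obtain ⟨m, b, hb⟩ := hy
    refine ⟨n + m, a * f ^ m + b * f ^ n, ?_⟩
    simp only [map_add, map_mul, map_pow, ← ha, ← hb]
    ring
  | neg x _ hx =>
    obtain ⟨n, a, ha⟩ := hx
    exact ⟨n, -a, by rw [map_neg, ← ha, neg_mul]⟩
  | mul x y _ _ hx hy =>
    obtain ⟨n, a, ha⟩ := hx
    obtain ⟨m, b, hb⟩ := hy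
    refine ⟨n + m, a * b, ?_⟩
    simp only [map_mul, ← ha, ← hb]
    ring

/-- If `f` is a prime element, then `(A_f)^×` is generated by `A^×` and `f`. -/
lemma exists_eq_mul_zpow_of_memAwayUnits {f : A} (hf : Prime f) {φ w : (FractionRing A)ˣ}
    (hφ : (φ : FractionRing A) = algebraMap A (FractionRing A) f) (hw : memAwayUnits A f w) :
    ∃ (a : Aˣ) (n : ℤ), w = unitsToFrac A a * φ ^ n := by
  obtain ⟨n, a, ha⟩ := exists_mul_pow_eq_of_mem_awaySubring hf.ne_zero hw.1
  obtain ⟨m, b, hb⟩ := exists_mul_pow_eq_of_mem_awaySubring hf.ne_zero hw.2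
  have hab : a * b = f ^ (n + m) := by
    apply IsFractionRing.injective A (FractionRing A)
    rw [map_mul, ← ha, ← hb, map_pow, mul_mul_mul_comm, Units.mul_inv, one_mul, pow_add]
  obtain ⟨i, -, c, hc⟩ := (dvd_prime_pow hf _).1 (Dvd.intro b hab)
  refine ⟨c⁻¹, (i : ℤ) - n, ?_⟩
  rw [map_inv, zpow_sub, zpow_natCast, zpow_natCast, ← mul_assoc, eq_mul_inv_iff_mul_eq,
    eq_inv_mul_iff_mul_eq]
  ext
  simp only [Units.val_mul, Units.val_pow_eq_pow_val, Units.coe_map, MonoidHom.coe_coe, hφ, ha]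
  rw [← map_mul, ← map_pow, ← hc, mul_comm]

/-- The subgroup of `K^M_2(F)` generated by the symbols `{w, u}` with `w ∈ A^×` and
`u ∈ ker(A^× → (A/I)^×)`. -/
def relativePairs (I : Ideal A) : AddSubgroup (KRing (FractionRing A)) :=
  AddSubgroup.closure { x | ∃ w u : Aˣ, (u : A) - 1 ∈ I ∧ x = fracSymbol w * fracSymbol u }

lemma fracSymbol_mul_fracSymbol_mem {I : Ideal A} {u : Aˣ} (hu : (u : A) - 1 ∈ I) (w : Aˣ) :
    fracSymbol u * fracSymbol w ∈ relativePairs I := by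
  rw [unitSymbol_mul_comm]
  exact neg_mem (AddSubgroup.subset_closure ⟨w, u, hu, rfl⟩)

/-- The case of a unit `1 + f a` with `a` a unit: here `{1 + f a, f} = {1 + f a, (-a)⁻¹}` by the
Steinberg relation. -/
lemma fracSymbol_mul_prime_mem_of_unit {f : A} {φ : (FractionRing A)ˣ}
    (hφ : (φ : FractionRing A) = algebraMap A (FractionRing A) f) {u a : Aˣ}
    (hu : (u : A) = 1 + f * a) :
    fracSymbol u * unitSymbol (FractionRing A) (.ofMul φ) ∈ relativePairs (Ideal.span {f}) := by
  have h0 := unitSymbol_mul_unitSymbol_eq_zero (unitsToFrac A u) (φ * unitsToFrac A (-a)) (by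
    simp only [Units.val_mul, Units.coe_map, MonoidHom.coe_coe, hφ, ← map_mul, ← map_add, hu]
    simp)
  have hsplit : φ = φ * unitsToFrac A (-a) * unitsToFrac A (-a)⁻¹ := by
    rw [map_inv, mul_inv_cancel_right]
  rw [hsplit, unitSymbol_mul, mul_add, h0, zero_add]
  refine fracSymbol_mul_fracSymbol_mem ?_ _
  rw [hu, add_sub_cancel_left]
  exact Ideal.mul_mem_right _ _ (Ideal.mem_span_singleton_self f)

lemma fracSymbol_mul_prime_mem [IsLocalRing A] {f : A} (hf : ¬ IsUnit f)
    {φ : (FractionRing A)ˣ} (hφ : (φ : FractionRing A) = algebraMap A (FractionRing A) f)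
    {u : Aˣ} (hu : (u : A) - 1 ∈ Ideal.span {f}) :
    fracSymbol u * unitSymbol (FractionRing A) (.ofMul φ) ∈ relativePairs (Ideal.span {f}) := by
  obtain ⟨a, ha⟩ := Ideal.mem_span_singleton.1 hu
  by_cases hau : IsUnit a
  · obtain ⟨a, rfl⟩ := hau
    exact fracSymbol_mul_prime_mem_of_unit hφ (sub_eq_iff_eq_add'.1 ha)
  have hunit : ∀ b : A, ¬ IsUnit b → IsUnit (1 + b) := fun b hb => by
    rcases IsLocalRing.isUnit_or_isUnit_of_add_one (a := 1 + b) (b := -b) (by ring) with h | h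
    · exact h
    · exact absurd ((IsUnit.neg_iff b).1 h) hb
  obtain ⟨v, hv⟩ := hunit f hf
  obtain ⟨d, hd⟩ : IsUnit (a - 1) := by
    rw [← IsUnit.neg_iff, neg_sub, sub_eq_add_neg]
    exact hunit _ (by rwa [IsUnit.neg_iff])
  have huv : u = v * (u * v⁻¹) := by rw [mul_comm u, mul_inv_cancel_left]
  rw [huv, fracSymbol, map_mul, unitSymbol_mul, add_mul]
  refine add_mem (fracSymbol_mul_prime_mem_of_unit (a := 1) hφ (by simp [hv]))
    (fracSymbol_mul_prime_mem_of_unit (a := d * v⁻¹) hφ ?_)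
  rw [Units.val_mul, Units.val_mul, hd, ← mul_assoc, Units.mul_inv_eq_iff_eq_mul, add_mul,
    mul_assoc, Units.inv_mul, hv, sub_eq_iff_eq_add.1 ha]
  ring

/-- For `f` prime, `{u, w}` with `u ≡ 1 mod f` and `w ∈ (A_f)^×` is a sum of symbols with
entries in `A^×`. -/
lemma fracSymbol_mul_mem_of_memAwayUnits [IsLocalRing A] {f : A} (hf : Prime f) {u : Aˣ}
    (hu : (u : A) - 1 ∈ Ideal.span {f}) {w : (FractionRing A)ˣ} (hw : memAwayUnits A f w) :
    fracSymbol u * unitSymbol (FractionRing A) (.ofMul w) ∈ relativePairs (Ideal.span {f}) := by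
  let φ : (FractionRing A)ˣ :=
    Units.mk0 (algebraMap A (FractionRing A) f) (by simpa using hf.ne_zero)
  obtain ⟨a, n, rfl⟩ := exists_eq_mul_zpow_of_memAwayUnits (φ := φ) hf rfl hw
  rw [unitSymbol_mul, mul_add]
  refine add_mem (fracSymbol_mul_fracSymbol_mem hu a) ?_
  have hn : fracSymbol u * unitSymbol (FractionRing A) (.ofMul (φ ^ n)) =
      n • (fracSymbol u * unitSymbol (FractionRing A) (.ofMul φ)) :=
    map_zsmul ((AddMonoidHom.mulLeft (fracSymbol u)).comp (unitSymbol (FractionRing A))) n _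
  rw [hn]
  exact zsmul_mem (fracSymbol_mul_prime_mem hf.not_isUnit rfl hu) n

lemma ksymbol_cons_mem_eGroup [IsLocalRing A] {f : A} (hf : Prime f)
    (v : List (FractionRing A)ˣ) (hv : ∀ w ∈ v, memAwayUnits A f w) {u : Aˣ}
    (hu : (u : A) - 1 ∈ Ideal.span {f}) :
    ksymbol (unitsToFrac A u :: v) ∈ eGroup A (Ideal.span {f}) (v.length + 1) := by
  induction v generalizing u with
  | nil => rw [ksymbol_singleton]; exact fracSymbol_mem_eGroup hu
  | cons w v ih =>
    rw [ksymbol_cons, ksymbol_cons, ← mul_assoc]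
    refine mul_mem_of_mem_closure (T := {ksymbol v}) ?_
      (fracSymbol_mul_mem_of_memAwayUnits hf hu (hv w List.mem_cons_self))
      (AddSubgroup.mem_closure_singleton_self _)
    rintro _ ⟨w', u', hu', rfl⟩ _ rfl
    rw [mul_assoc, ← ksymbol_cons]
    exact fracSymbol_mul_mem_eGroup w' (ih (fun x hx => hv x (List.mem_cons_of_mem w hx)) hu')

lemma hatKGroup_le_eGroup [IsLocalRing A] {f : A} (hf : Prime f) {r : ℕ} (hr : 1 ≤ r) :
    hatKGroup A f (Ideal.span {f}) r ≤ eGroup A (Ideal.span {f}) r := by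
  refine (AddSubgroup.closure_le _).2 ?_
  rintro _ ⟨u, hu, v, hlen, hv, rfl⟩
  have hr' : r = v.length + 1 := by omega
  rw [hr']
  exact ksymbol_cons_mem_eGroup hf v hv hu

end fraction

end MilnorKTheory

open MilnorKTheory in
/-- Let `A` be a local domain with fraction field `F` and let `I = (f)` be
the principal ideal generated by a nonzero `f ∈ A`.  For `r ≥ 1` let `E_r(A,I) ⊆ K^M_r(F)` be
the image of `K^M_r(A,I) → K^M_r(F)` and let `K̂^M_r(A|I) ⊆ K^M_r(F)` be the image of the
product map `K^M_1(A,I) ⊗ (A_f)^× ⊗ ⋯ ⊗ (A_f)^× → K^M_r(F)` (with `r − 1` factors `(A_f)^×`).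
Then `E_r(A,I) ⊆ K̂^M_r(A|I)`, and this inclusion is an equality if `I` is a prime ideal. -/
theorem eGroup_le_hatKGroup
    (A : Type*) [CommRing A] [IsDomain A] [IsLocalRing A] (f : A) (hf : f ≠ 0)
    (r : ℕ) (hr : 1 ≤ r) :
    eGroup A (Ideal.span {f}) r ≤ hatKGroup A f (Ideal.span {f}) r ∧
    ((Ideal.span {f}).IsPrime →
      eGroup A (Ideal.span {f}) r = hatKGroup A f (Ideal.span {f}) r) := by
  exact ⟨eGroup_le_hatKGroup_of_one_le f _ hr, fun hp => le_antisymm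
    (eGroup_le_hatKGroup_of_one_le f _ hr)
    (hatKGroup_le_eGroup ((Ideal.span_singleton_prime hf).1 hp) hr)⟩
end

section
/- Let p be a prime, A an 𝔽_p-algebra, f ∈ A, and A_f = A[1/f]. For m ≥ 1 and n ∈ ℤ let W_m^{(n)}(A,f) := [f]^{-n}·ι(W_m(A)) ⊆ W_m(A_f), where ι: W_m(A) → W_m(A_f) is the canonical map and [f] ∈ W_m(A_f)^× is the Teichmüller representative of the unit f. Then: (1) the Frobenius F: W_{m+1}(A_f) → W_m(A_f) maps W_{m+1}^{(n)}(A,f) into W_m^{(pn)}(A,f); (2) the Verschiebung V: W_m(A_f) → W_{m+1}(A_f) maps W_m^{(pn)}(A,f) into W_{m+1}^{(n)}(A,f); (3) the restriction R: W_{m+1}(A_f) → W_m(A_f) maps W_{m+1}^{(n)}(A,f) into W_m^{(n)}(A,f). -/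
noncomputable section

open TruncatedWittVector

variable (p : ℕ) [hp : Fact p.Prime]

/-- The coordinatewise map of truncated Witt vectors along a ring homomorphism. -/
def twvMap {B C : Type*} [CommRing B] [CommRing C] (φ : B →+* C) {m : ℕ}
    (x : TruncatedWittVector p m B) : TruncatedWittVector p m C :=
  TruncatedWittVector.mk p fun i => φ (x.coeff i)

/-- The Verschiebung `V : W_m(B) → W_{m+1}(B)`, shifting coordinates by one. -/
def twvV {B : Type*} [CommRing B] {m : ℕ} (x : TruncatedWittVector p m B) :
    TruncatedWittVector p (m + 1) B :=
  TruncatedWittVector.mk p (Fin.cases 0 fun i => x.coeff i)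

/-- The Frobenius `F : W_{m+1}(B) → W_m(B)` of a ring `B` of characteristic `p`,
induced coordinatewise by the `p`-th power map composed with truncation. -/
def twvF {B : Type*} [CommRing B] {m : ℕ} (x : TruncatedWittVector p (m + 1) B) :
    TruncatedWittVector p m B :=
  TruncatedWittVector.mk p fun i => (x.coeff i.castSucc) ^ p

/-- The restriction (truncation) `R : W_{m+1}(B) → W_m(B)`. -/
def twvR {B : Type*} [CommRing B] {m : ℕ} :
    TruncatedWittVector p (m + 1) B →+* TruncatedWittVector p m B :=
  TruncatedWittVector.truncate (Nat.le_succ m)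

/-- The `i`-fold iterated Verschiebung `V^i : W_a(B) → W_{a+i}(B)`. -/
def twvViter {B : Type*} [CommRing B] : (i : ℕ) → {a : ℕ} →
    TruncatedWittVector p a B → TruncatedWittVector p (a + i) B
  | 0, _, x => x
  | i + 1, _, x => twvV p (twvViter i x)

/-- The `j`-fold iterated Frobenius `F^j : W_{j+1}(B) → W_1(B)`. -/
def twvFpow {B : Type*} [CommRing B] : {j : ℕ} →
    TruncatedWittVector p (j + 1) B → TruncatedWittVector p 1 B
  | 0, x => x
  | _ + 1, x => twvFpow (twvF p x)

/-- The Teichmüller representative `[·] : B →* W_m(B)`. -/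
def twvTeichmuller {B : Type*} [CommRing B] (m : ℕ) : B →* TruncatedWittVector p m B :=
  (WittVector.truncate m).toMonoidHom.comp (WittVector.teichmuller p)

variable (A : Type*) [CommRing A] (f : A)

/-- `f` becomes a unit in the localization `A_f = A[1/f]`. -/
def awayUnit : (Localization.Away f)ˣ :=
  (IsLocalization.Away.algebraMap_isUnit (S := Localization.Away f) f).unit

/-- The Teichmüller representative `[f]` of `f`, as a unit of `W_m(A_f)`. -/
def twvTeichUnit (m : ℕ) : (TruncatedWittVector p m (Localization.Away f))ˣ :=
  Units.map (twvTeichmuller p (B := Localization.Away f) m) (awayUnit A f)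

/-- The canonical (coordinatewise) map `ι : W_m(A) → W_m(A_f)`. -/
def twvLoc (m : ℕ) (x : TruncatedWittVector p m A) :
    TruncatedWittVector p m (Localization.Away f) :=
  twvMap p (algebraMap A (Localization.Away f)) x

/-- The twisted subset `W_m^{(n)}(A,f) = [f]^{-n} · ι(W_m(A)) ⊆ W_m(A_f)`. -/
def twistedWitt (m : ℕ) (n : ℤ) : Set (TruncatedWittVector p m (Localization.Away f)) :=
  { y | ∃ x : TruncatedWittVector p m A,
      y = (↑(twvTeichUnit p A f m ^ (-n)) : TruncatedWittVector p m (Localization.Away f))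
            * twvLoc p A f m x }

end

open WittVector in
theorem mem_twistedWitt_iff (p : ℕ) [Fact p.Prime] (A : Type*) [CommRing A] (f : A) (m : ℕ) (n : ℤ)
    (y : TruncatedWittVector p m (Localization.Away f)) :
    y ∈ twistedWitt p A f m n ↔ ∃ x : WittVector p A,
      y = truncate m (teichmuller p ((awayUnit A f ^ (-n) : (Localization.Away f)ˣ) :
        Localization.Away f) * map (algebraMap A (Localization.Away f)) x) := by
  have hu : ((twvTeichUnit p A f m ^ (-n) : (TruncatedWittVector p m (Localization.Away f))ˣ) :
      TruncatedWittVector p m (Localization.Away f)) =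
      truncate m (teichmuller p ((awayUnit A f ^ (-n) : (Localization.Away f)ˣ) :
        Localization.Away f)) := by
    rw [twvTeichUnit, ← map_zpow, Units.coe_map]
    rfl
  have hl (x : WittVector p A) : twvLoc p A f m (truncate m x) =
      truncate m (map (algebraMap A (Localization.Away f)) x) := by
    ext i
    simp [twvLoc, twvMap]
  simp only [twistedWitt, Set.mem_ofPred_eq, hu, map_mul,
    (truncate_surjective p m A).exists, hl]

theorem twvV_truncate (p : ℕ) [Fact p.Prime] {B : Type*} [CommRing B] (m : ℕ)
    (x : WittVector p B) :
    twvV p (WittVector.truncate m x) = WittVector.truncate (m + 1) (WittVector.verschiebung x) := by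
  ext i
  refine Fin.cases ?_ (fun j => ?_) i
  · simp [twvV]
  · simp [twvV]

theorem twvF_truncate (p : ℕ) [Fact p.Prime] {B : Type*} [CommRing B] [CharP B p] (m : ℕ)
    (x : WittVector p B) :
    twvF p (WittVector.truncate (m + 1) x) = WittVector.truncate m (WittVector.frobenius x) := by
  ext i
  simp [twvF, WittVector.coeff_frobenius_charP]

theorem WittVector.frobenius_teichmuller_charP (p : ℕ) [Fact p.Prime] {B : Type*} [CommRing B]
    [CharP B p] (b : B) :
    WittVector.frobenius (teichmuller p b) = teichmuller p (b ^ p) := by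
  ext i
  cases i with
  | zero => rw [coeff_frobenius_charP, teichmuller_coeff_zero, teichmuller_coeff_zero]
  | succ i =>
    rw [coeff_frobenius_charP, teichmuller_coeff_pos _ _ _ i.succ_pos,
      teichmuller_coeff_pos _ _ _ i.succ_pos, zero_pow (Fact.out : p.Prime).ne_zero]

/-- Let `p` be a prime, `A` an `𝔽_p`-algebra, `f ∈ A`, and `A_f = A[1/f]`.
For `m ≥ 1` and `n ∈ ℤ` let `W_m^{(n)}(A,f) := [f]^{-n}·ι(W_m(A)) ⊆ W_m(A_f)`.  Then:
(1) the Frobenius `F : W_{m+1}(A_f) → W_m(A_f)` maps `W_{m+1}^{(n)}(A,f)` into `W_m^{(pn)}(A,f)`;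
(2) the Verschiebung `V : W_m(A_f) → W_{m+1}(A_f)` maps `W_m^{(pn)}(A,f)` into
    `W_{m+1}^{(n)}(A,f)`;
(3) the restriction `R : W_{m+1}(A_f) → W_m(A_f)` maps `W_{m+1}^{(n)}(A,f)` into
    `W_m^{(n)}(A,f)`. -/
theorem twistedWitt_frobenius_verschiebung_restriction_mapsTo
    (p : ℕ) [Fact p.Prime] (A : Type*) [CommRing A] [Algebra (ZMod p) A] (f : A)
    (m : ℕ) (hm : 1 ≤ m) (n : ℤ) :
    Set.MapsTo (twvF p) (twistedWitt p A f (m + 1) n) (twistedWitt p A f m ((p : ℤ) * n)) ∧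
    Set.MapsTo (twvV p) (twistedWitt p A f m ((p : ℤ) * n)) (twistedWitt p A f (m + 1) n) ∧
    Set.MapsTo (twvR p) (twistedWitt p A f (m + 1) n) (twistedWitt p A f m n) := by
  rcases subsingleton_or_nontrivial (Localization.Away f) with hB | hB
  · have hmem (k : ℕ) (l : ℤ) (y : TruncatedWittVector p k (Localization.Away f)) :
        y ∈ twistedWitt p A f k l :=
      ⟨0, TruncatedWittVector.ext fun _ => Subsingleton.elim _ _⟩
    exact ⟨fun _ _ => hmem _ _ _, fun _ _ => hmem _ _ _, fun _ _ => hmem _ _ _⟩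
  have : CharP (Localization.Away f) p := charP_of_injective_ringHom
    ((algebraMap A (Localization.Away f)).comp (algebraMap (ZMod p) A)).injective p
  have hF : WittVector.frobenius (WittVector.teichmuller p
      ((awayUnit A f ^ (-n) : (Localization.Away f)ˣ) : Localization.Away f)) =
      WittVector.teichmuller p
        ((awayUnit A f ^ (-((p : ℤ) * n)) : (Localization.Away f)ˣ) : Localization.Away f) := by
    rw [WittVector.frobenius_teichmuller_charP, ← Units.val_pow_eq_pow_val, ← zpow_natCast,
      ← zpow_mul, neg_mul, mul_comm n]
  refine ⟨fun y hy => ?_, fun y hy => ?_, fun y hy => ?_⟩ <;>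
    rw [mem_twistedWitt_iff] at hy ⊢ <;> obtain ⟨x, rfl⟩ := hy
  · refine ⟨WittVector.frobenius x, ?_⟩
    rw [twvF_truncate, map_mul WittVector.frobenius, hF,
      (WittVector.frobenius_isPoly p).map]
  · refine ⟨WittVector.verschiebung x, ?_⟩
    rw [twvV_truncate, ← hF, mul_comm, WittVector.verschiebung_mul_frobenius, mul_comm,
      WittVector.map_verschiebung]
  · exact ⟨x, TruncatedWittVector.truncate_wittVector_truncate _ _⟩
end

section
/- Let p be a prime, A an 𝔽_p-algebra, f ∈ A, and A_f = A[1/f]. For m ≥ 1 and n ∈ ℤ let W_m^{(n)}(A,f) := [f]^{-n}·ι(W_m(A)) ⊆ W_m(A_f). Then for every integer q ≥ 1, the union over n ≥ 1 of the subgroups W_m^{(qn)}(A,f) equals all of W_m(A_f); equivalently, for every x ∈ W_m(A_f) there exists n ≥ 1 such that [f]^{qn}·x lies in the image of ι: W_m(A) → W_m(A_f). -/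
namespace WittVector

open MvPolynomial

variable {p : ℕ} [Fact p.Prime]

theorem teichmuller_mul_mvPolynomial_rat {σ : Type*} (r : MvPolynomial σ ℚ)
    (x : WittVector p (MvPolynomial σ ℚ)) :
    teichmuller p r * x = WittVector.mk p fun n => r ^ p ^ n * x.coeff n := by
  apply (ghostMap.bijective_of_invertible p (MvPolynomial σ ℚ)).1
  rw [map_mul]
  ext1 n
  simp only [Pi.mul_apply, ghostMap_apply, ghostComponent_teichmuller]
  simp only [ghostComponent_apply, aeval_wittPolynomial, Finset.mul_sum]
  refine Finset.sum_congr rfl fun i hi => ?_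
  have hin : i ≤ n := Nat.lt_succ_iff.mp (Finset.mem_range.mp hi)
  rw [WittVector.coeff_mk, mul_pow, ← pow_mul, ← pow_add, Nat.add_sub_cancel' hin]
  ring

theorem teichmuller_mul_mvPolynomial_int {σ : Type*} (r : MvPolynomial σ ℤ)
    (x : WittVector p (MvPolynomial σ ℤ)) :
    teichmuller p r * x = WittVector.mk p fun n => r ^ p ^ n * x.coeff n := by
  refine map_injective (MvPolynomial.map (Int.castRingHom ℚ))
    (MvPolynomial.map_injective _ Int.cast_injective) ?_
  rw [map_mul, map_teichmuller, teichmuller_mul_mvPolynomial_rat]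
  ext n
  simp [map_coeff]

/-- Multiplication by a Teichmüller representative scales the `n`-th coefficient by `r ^ p ^ n`. -/
theorem teichmuller_mul_coeff {R : Type*} [CommRing R] (r : R) (x : WittVector p R) (n : ℕ) :
    (teichmuller p r * x).coeff n = r ^ p ^ n * x.coeff n := by
  obtain ⟨r, rfl⟩ := counit_surjective R r
  obtain ⟨x, rfl⟩ := map_surjective _ (counit_surjective R) x
  rw [← map_teichmuller, ← map_mul, teichmuller_mul_mvPolynomial_int]
  simp [map_coeff]

end WittVector

theorem twvTeichmuller_mul_coeff {p : ℕ} [Fact p.Prime] {B : Type*} [CommRing B] {m : ℕ} (b : B)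
    (x : TruncatedWittVector p m B) (i : Fin m) :
    (twvTeichmuller p m b * x).coeff i = b ^ p ^ (i : ℕ) * x.coeff i := by
  obtain ⟨x, rfl⟩ := WittVector.truncate_surjective p m B x
  change (WittVector.truncate m (WittVector.teichmuller p b) * WittVector.truncate m x).coeff i = _
  rw [← map_mul, WittVector.coeff_truncate, WittVector.coeff_truncate,
    WittVector.teichmuller_mul_coeff]

theorem exists_twvTeichUnit_pow_mul_mem_range_twvLoc (p : ℕ) [Fact p.Prime] (A : Type*)
    [CommRing A] (f : A) (m : ℕ) (x : TruncatedWittVector p m (Localization.Away f)) :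
    ∃ N : ℕ, ∀ k : ℕ, N ≤ k →
      (↑(twvTeichUnit p A f m ^ k) : TruncatedWittVector p m (Localization.Away f)) * x
        ∈ Set.range (twvLoc p A f m) := by
  obtain ⟨⟨_, N, rfl⟩, hN⟩ := IsLocalization.exist_integer_multiples_of_finite
    (Submonoid.powers f) fun i => x.coeff i
  refine ⟨N, fun k hk => ?_⟩
  have hcoeff (i : Fin m) : ∃ a : A, algebraMap A (Localization.Away f) a =
      algebraMap A (Localization.Away f) (f ^ k) ^ p ^ (i : ℕ) * x.coeff i := by
    obtain ⟨a, ha⟩ := hN i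
    have hle : N ≤ k * p ^ (i : ℕ) :=
      hk.trans (Nat.le_mul_of_pos_right k (pow_pos (Fact.out : p.Prime).pos _))
    refine ⟨f ^ (k * p ^ (i : ℕ) - N) * a, ?_⟩
    rw [map_mul, ha, Algebra.smul_def, ← mul_assoc, ← map_mul, ← pow_add, Nat.sub_add_cancel hle,
      pow_mul, map_pow]
  choose a ha using hcoeff
  have hunit : (↑(twvTeichUnit p A f m ^ k) : TruncatedWittVector p m (Localization.Away f)) =
      twvTeichmuller p m (algebraMap A (Localization.Away f) (f ^ k)) := by
    rw [Units.val_pow_eq_pow_val, map_pow, map_pow]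
    rfl
  refine ⟨TruncatedWittVector.mk p a, TruncatedWittVector.ext fun i => ?_⟩
  rw [hunit, twvTeichmuller_mul_coeff, ← ha]
  simp [twvLoc, twvMap]

/-- Let `p` be a prime, `A` an `𝔽_p`-algebra, `f ∈ A`, and `A_f = A[1/f]`.
For `m ≥ 1` and `n ∈ ℤ` let `W_m^{(n)}(A,f) := [f]^{-n}·ι(W_m(A)) ⊆ W_m(A_f)`.  Then for every
integer `q ≥ 1`, the union over `n ≥ 1` of the subgroups `W_m^{(qn)}(A,f)` equals all of
`W_m(A_f)`; equivalently, for every `x ∈ W_m(A_f)` there exists `n ≥ 1` such that `[f]^{qn}·x`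
lies in the image of `ι : W_m(A) → W_m(A_f)`. -/
theorem twistedWitt_iUnion_eq_univ
    (p : ℕ) [Fact p.Prime] (A : Type*) [CommRing A] [Algebra (ZMod p) A] (f : A)
    (m : ℕ) (hm : 1 ≤ m) (q : ℕ) (hq : 1 ≤ q) :
    (⋃ n : ℕ, ⋃ _ : 1 ≤ n, twistedWitt p A f m ((q : ℤ) * n)) = Set.univ ∧
    ∀ x : TruncatedWittVector p m (Localization.Away f),
      ∃ n : ℕ, 1 ≤ n ∧
        (↑(twvTeichUnit p A f m ^ (q * n)) : TruncatedWittVector p m (Localization.Away f)) * x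
          ∈ Set.range (twvLoc p A f m) := by
  have hmem (x : TruncatedWittVector p m (Localization.Away f)) : ∃ n : ℕ, 1 ≤ n ∧
      (↑(twvTeichUnit p A f m ^ (q * n)) : TruncatedWittVector p m (Localization.Away f)) * x
        ∈ Set.range (twvLoc p A f m) := by
    obtain ⟨N, hN⟩ := exists_twvTeichUnit_pow_mul_mem_range_twvLoc p A f m x
    exact ⟨N + 1, Nat.le_add_left 1 N,
      hN _ ((Nat.le_succ N).trans (Nat.le_mul_of_pos_left _ hq))⟩
  refine ⟨Set.eq_univ_of_forall fun x => ?_, hmem⟩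
  obtain ⟨n, hn, y, hy⟩ := hmem x
  refine Set.mem_iUnion₂.mpr ⟨n, hn, y, ?_⟩
  rw [hy, ← mul_assoc, ← Units.val_mul, ← Nat.cast_mul, zpow_neg, zpow_natCast, inv_mul_cancel,
    Units.val_one, one_mul]
end

section
/- Let p be a prime and A a reduced 𝔽_p-algebra (for instance a regular 𝔽_p-algebra), f ∈ A, and A_f = A[1/f]. For m ≥ 1 and n ∈ ℤ let W_m^{(n)}(A,f) := [f]^{-n}·ι(W_m(A)) ⊆ W_m(A_f). On Witt vectors of the reduced ring A_f, the kernel of the restriction R: W_{m+1}(A_f) → W_m(A_f) is contained in the kernel of multiplication by p, so there is a unique additive map p̄: W_m(A_f) → W_{m+1}(A_f) with p̄ ∘ R = p·(−). Then the multiplication-by-p map on W_{m+1}^{(n)}(A,f) factors as the surjective restriction R: W_{m+1}^{(n)}(A,f) ↠ W_m^{(n)}(A,f) followed by p̄, and p̄ restricts to an injective homomorphism W_m^{(n)}(A,f) ↪ W_{m+1}^{(n)}(A,f). -/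
open TruncatedWittVector

section

variable {p : ℕ} [Fact p.Prime] {B C : Type*} [CommRing B] [CommRing C] {m : ℕ}

theorem charP_or_subsingleton_of_natCast_eq_zero (hB : (p : B) = 0) :
    CharP B p ∨ Subsingleton B := by
  rcases subsingleton_or_nontrivial B with h | h
  · exact Or.inr h
  · refine Or.inl ?_
    rcases (CharP.exists B) with ⟨q, hq⟩
    have hdvd : q ∣ p := (CharP.cast_eq_zero_iff B q p).1 hB
    rcases (Nat.dvd_prime Fact.out).1 hdvd with rfl | rfl
    · exact absurd rfl (CharP.char_ne_one B 1)
    · exact hq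

theorem TruncatedWittVector.coeff_nsmul_prime_zero (hB : (p : B) = 0)
    (y : TruncatedWittVector p (m + 1) B) : (p • y).coeff 0 = 0 := by
  rcases charP_or_subsingleton_of_natCast_eq_zero hB with h | h
  · obtain ⟨y, rfl⟩ := WittVector.truncate_surjective p (m + 1) B y
    rw [← map_nsmul, WittVector.coeff_truncate, nsmul_eq_mul, mul_comm]
    exact WittVector.mul_charP_coeff_zero y
  · exact Subsingleton.elim _ _

theorem TruncatedWittVector.coeff_nsmul_prime_succ (hB : (p : B) = 0)
    (y : TruncatedWittVector p (m + 1) B) (i : Fin m) :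
    (p • y).coeff i.succ = y.coeff i.castSucc ^ p := by
  rcases charP_or_subsingleton_of_natCast_eq_zero hB with h | h
  · obtain ⟨y, rfl⟩ := WittVector.truncate_surjective p (m + 1) B y
    rw [← map_nsmul, WittVector.coeff_truncate, WittVector.coeff_truncate, nsmul_eq_mul, mul_comm]
    exact WittVector.mul_charP_coeff_succ y i
  · exact Subsingleton.elim _ _

theorem coeff_twvR (y : TruncatedWittVector p (m + 1) B) (i : Fin m) :
    (twvR p y).coeff i = y.coeff i.castSucc :=
  TruncatedWittVector.coeff_truncate _ _ _

theorem twvR_surjective :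
    Function.Surjective (twvR p : TruncatedWittVector p (m + 1) B →+* _) :=
  TruncatedWittVector.truncate_surjective _

theorem twvR_twvTeichmuller (b : B) :
    twvR p (twvTeichmuller p (m + 1) b) = twvTeichmuller p m b :=
  TruncatedWittVector.truncate_wittVector_truncate (Nat.le_succ m) (WittVector.teichmuller p b)

theorem twvR_twvMap (φ : B →+* C) (x : TruncatedWittVector p (m + 1) B) :
    twvR p (twvMap p φ x) = twvMap p φ (twvR p x) := by
  ext i
  simp only [coeff_twvR, twvMap, coeff_mk]

theorem twvMap_nsmul_prime (φ : B →+* C) (hB : (p : B) = 0)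
    (x : TruncatedWittVector p (m + 1) B) : twvMap p φ (p • x) = p • twvMap p φ x := by
  have hC : (p : C) = 0 := by rw [← map_natCast φ, hB, map_zero]
  ext i
  refine Fin.cases ?_ (fun j => ?_) i
  · simp only [twvMap, coeff_mk, coeff_nsmul_prime_zero hB, coeff_nsmul_prime_zero hC, map_zero]
  · simp only [twvMap, coeff_mk, coeff_nsmul_prime_succ hB, coeff_nsmul_prime_succ hC, map_pow]

theorem nsmul_prime_eq_of_twvR_eq (hB : (p : B) = 0) {y z : TruncatedWittVector p (m + 1) B}
    (h : twvR p y = twvR p z) : p • y = p • z := by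
  ext i
  refine Fin.cases ?_ (fun j => ?_) i
  · rw [coeff_nsmul_prime_zero hB, coeff_nsmul_prime_zero hB]
  · rw [coeff_nsmul_prime_succ hB, coeff_nsmul_prime_succ hB, ← coeff_twvR, ← coeff_twvR, h]

theorem twvR_eq_of_nsmul_prime_eq [IsReduced B] (hB : (p : B) = 0)
    {y z : TruncatedWittVector p (m + 1) B} (h : p • y = p • z) : twvR p y = twvR p z := by
  ext i
  rcases charP_or_subsingleton_of_natCast_eq_zero hB with hp | hs
  · have hi := congrArg (TruncatedWittVector.coeff i.succ) h
    rw [coeff_nsmul_prime_succ hB, coeff_nsmul_prime_succ hB] at hi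
    rw [coeff_twvR, coeff_twvR]
    exact frobenius_inj B p hi
  · exact Subsingleton.elim _ _

end

section

variable {p : ℕ} [Fact p.Prime] {A : Type*} [CommRing A] {f : A} {m : ℕ}

theorem twvR_twvTeichUnit_zpow (k : ℤ) :
    twvR p (↑(twvTeichUnit p A f (m + 1) ^ k) :
      TruncatedWittVector p (m + 1) (Localization.Away f)) = ↑(twvTeichUnit p A f m ^ k) := by
  have h : Units.map (twvR p : TruncatedWittVector p (m + 1) (Localization.Away f) →+* _).toMonoidHom
      (twvTeichUnit p A f (m + 1)) = twvTeichUnit p A f m :=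
    Units.ext (twvR_twvTeichmuller _)
  rw [← h, ← map_zpow]
  rfl

theorem twvR_twist_twvLoc (k : ℤ) (x : TruncatedWittVector p (m + 1) A) :
    twvR p ((↑(twvTeichUnit p A f (m + 1) ^ k) :
        TruncatedWittVector p (m + 1) (Localization.Away f)) * twvLoc p A f (m + 1) x) =
      (↑(twvTeichUnit p A f m ^ k) : TruncatedWittVector p m (Localization.Away f)) *
        twvLoc p A f m (twvR p x) := by
  rw [map_mul, twvR_twvTeichUnit_zpow, twvLoc, twvR_twvMap, twvLoc]

theorem mapsTo_twvR_twistedWitt (n : ℤ) :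
    Set.MapsTo (twvR p) (twistedWitt p A f (m + 1) n) (twistedWitt p A f m n) := by
  rintro _ ⟨x, rfl⟩
  exact ⟨twvR p x, twvR_twist_twvLoc _ _⟩

theorem surjOn_twvR_twistedWitt (n : ℤ) :
    Set.SurjOn (twvR p) (twistedWitt p A f (m + 1) n) (twistedWitt p A f m n) := by
  rintro _ ⟨x, rfl⟩
  obtain ⟨x, rfl⟩ := twvR_surjective x
  exact ⟨_, ⟨x, rfl⟩, twvR_twist_twvLoc _ _⟩

theorem nsmul_prime_mem_twistedWitt (hA : (p : A) = 0) {n : ℤ}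
    {y : TruncatedWittVector p (m + 1) (Localization.Away f)}
    (hy : y ∈ twistedWitt p A f (m + 1) n) : p • y ∈ twistedWitt p A f (m + 1) n := by
  obtain ⟨x, rfl⟩ := hy
  exact ⟨p • x, by rw [twvLoc, twvLoc, twvMap_nsmul_prime _ hA, mul_smul_comm]⟩

end


/-- Let `p` be a prime, `A` a reduced `𝔽_p`-algebra, `f ∈ A`, and
`A_f = A[1/f]`.  For `m ≥ 1` and `n ∈ ℤ` let `W_m^{(n)}(A,f) := [f]^{-n}·ι(W_m(A)) ⊆ W_m(A_f)`.
On Witt vectors of the reduced ring `A_f`, the kernel of the restriction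
`R : W_{m+1}(A_f) → W_m(A_f)` is contained in the kernel of multiplication by `p`, so there is a
unique additive map `p̄ : W_m(A_f) → W_{m+1}(A_f)` with `p̄ ∘ R = p·(−)`.  Then the
multiplication-by-`p` map on `W_{m+1}^{(n)}(A,f)` factors as the surjective restriction
`R : W_{m+1}^{(n)}(A,f) ↠ W_m^{(n)}(A,f)` followed by `p̄`, and `p̄` restricts to an injective
homomorphism `W_m^{(n)}(A,f) ↪ W_{m+1}^{(n)}(A,f)`. -/
theorem twistedWitt_pbar
    (p : ℕ) [Fact p.Prime] (A : Type*) [CommRing A] [Algebra (ZMod p) A] [IsReduced A] (f : A)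
    (m : ℕ) (hm : 1 ≤ m) (n : ℤ) :
    (∀ y : TruncatedWittVector p (m + 1) (Localization.Away f), twvR p y = 0 → p • y = 0) ∧
    (∃! pbar : TruncatedWittVector p m (Localization.Away f) →+
        TruncatedWittVector p (m + 1) (Localization.Away f),
      ∀ y, pbar (twvR p y) = p • y) ∧
    (∀ pbar : TruncatedWittVector p m (Localization.Away f) →+
        TruncatedWittVector p (m + 1) (Localization.Away f),
      (∀ y, pbar (twvR p y) = p • y) →
        Set.MapsTo (twvR p) (twistedWitt p A f (m + 1) n) (twistedWitt p A f m n) ∧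
        Set.SurjOn (twvR p) (twistedWitt p A f (m + 1) n) (twistedWitt p A f m n) ∧
        Set.MapsTo pbar (twistedWitt p A f m n) (twistedWitt p A f (m + 1) n) ∧
        Set.InjOn pbar (twistedWitt p A f m n)) := by
  have hA : (p : A) = 0 := by
    rw [← map_natCast (algebraMap (ZMod p) A), ZMod.natCast_self, map_zero]
  have hB : (p : Localization.Away f) = 0 := by
    rw [← map_natCast (algebraMap A (Localization.Away f)), hA, map_zero]
  have hker : ∀ y : TruncatedWittVector p (m + 1) (Localization.Away f),
      twvR p y = 0 → p • y = 0 := fun y hy => by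
    rw [nsmul_prime_eq_of_twvR_eq hB (hy.trans (map_zero _).symm), smul_zero]
  refine ⟨hker, ?_, fun pbar hpbar => ⟨mapsTo_twvR_twistedWitt n, surjOn_twvR_twistedWitt n, ?_, ?_⟩⟩
  · let R := (twvR p : TruncatedWittVector p (m + 1) (Localization.Away f) →+* _).toAddMonoidHom
    have hR : Function.Surjective R := twvR_surjective
    refine ⟨R.liftOfSurjective hR ⟨nsmulAddMonoidHom p, hker⟩,
      fun y => R.liftOfRightInverse_comp_apply _ _ ⟨nsmulAddMonoidHom p, hker⟩ y, fun g hg => ?_⟩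
    exact R.eq_liftOfRightInverse _ _ (nsmulAddMonoidHom p) hker g (AddMonoidHom.ext hg)
  · intro y hy
    obtain ⟨z, hz, rfl⟩ := surjOn_twvR_twistedWitt n hy
    rw [hpbar]
    exact nsmul_prime_mem_twistedWitt hA hz
  · intro y _ z _ h
    obtain ⟨y, rfl⟩ := twvR_surjective y
    obtain ⟨z, rfl⟩ := twvR_surjective z
    rw [hpbar, hpbar] at h
    exact twvR_eq_of_nsmul_prime_eq hB h
end
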